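/- arXiv:math/0001039 — 2 statements merged into one kernel-verified Lean document; each statement's English description precedes it below -/
import Mathlib

section
/- Let p be a C³ function on Γ×ℂⁿ. Then the composition operator P: (W^{1,2}(Γ))ⁿ → W^{1,2}(Γ) given by P(f)(z) = p(z, f(z)) is well-defined and continuously (Fréchet) differentiable, with derivative DP(f)[h](z) = Dp(z,f(z))[0, h(z)]. -/
open Complex Metric MeasureTheory Filter Set

noncomputable section

/-- The unit circle `Γ` in `ℂ`. -/
def Circ : Set ℂ := Metric.sphere (0 : ℂ) 1

/-- The closed unit disk `Δ` in `ℂ`. -/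
def Disk : Set ℂ := Metric.closedBall (0 : ℂ) 1

/-- The Euclidean norm on `ℂⁿ`. -/
def euclNorm {n : ℕ} (w : Fin n → ℂ) : ℝ := Real.sqrt (∑ j, Complex.normSq (w j))

/-- The complex partial derivative `∂g/∂wⱼ` of a real-valued function `g` on `ℂⁿ`. -/
def wderiv {n : ℕ} (g : (Fin n → ℂ) → ℝ) (w : Fin n → ℂ) (j : Fin n) : ℂ :=
  (((fderiv ℝ g w) (Pi.single j 1) : ℝ) - Complex.I * ((fderiv ℝ g w) (Pi.single j Complex.I) : ℝ)) / 2

/-- The affine complex tangent plane at `p` to the level set of `g` through `p`. -/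
def TangentPlane {n : ℕ} (g : (Fin n → ℂ) → ℝ) (p : Fin n → ℂ) : Set (Fin n → ℂ) :=
  {w | ∑ j, (w j - p j) * wderiv g p j = 0}

/-- `ρ` is strictly hypoconvex on a subset `U` of `Γ × ℂⁿ`: on every compact subset
there is `𝒦 > 0` such that the real Hessian in `w` is `≥ 𝒦‖u‖²` on complex tangent
vectors `u` of the fibers. -/
def StrictHypoconvexOn {n : ℕ} (ρ : ℂ → (Fin n → ℂ) → ℝ) (U : Set (ℂ × (Fin n → ℂ))) : Prop :=
  ∀ C : Set (ℂ × (Fin n → ℂ)), C ⊆ U → IsCompact C →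
    ∃ K0 > (0:ℝ), ∀ p ∈ C, ∀ u : Fin n → ℂ,
      (∑ j, u j * wderiv (ρ p.1) p.2 j) = 0 →
      K0 * (euclNorm u)^2 ≤ iteratedFDeriv ℝ 2 (ρ p.1) p.2 ![u, u]

/-- Two subsets of real normed spaces are (C⁶-)diffeomorphic: there are C⁶ maps on
open neighborhoods carrying one onto the other, inverse to each other on the sets. -/
def DiffeomorphicSets {E F : Type*} [NormedAddCommGroup E] [NormedSpace ℝ E]
    [NormedAddCommGroup F] [NormedSpace ℝ F] (A : Set E) (B : Set F) : Prop :=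
  ∃ (U : Set E) (V : Set F) (f : E → F) (g : F → E),
    IsOpen U ∧ IsOpen V ∧ A ⊆ U ∧ B ⊆ V ∧
    ContDiffOn ℝ 6 f U ∧ ContDiffOn ℝ 6 g V ∧
    Set.MapsTo f A B ∧ Set.MapsTo g B A ∧
    (∀ x ∈ A, g (f x) = x) ∧ (∀ y ∈ B, f (g y) = y)

/-- Condition (3) of the paper, for `ρ` with respect to `R` and `S`. -/
structure Cond3 (n : ℕ) (ρ : ℂ → (Fin n → ℂ) → ℝ) (R : ℝ) (S : ℂ → Fin n → ℂ) : Prop where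
  hn : 2 ≤ n
  nonneg : ∀ z ∈ Circ, ∀ w, 0 ≤ ρ z w
  cont : ContinuousOn (fun p : ℂ × (Fin n → ℂ) => ρ p.1 p.2) {p | p.1 ∈ Circ}
  smooth : ContDiffOn ℝ 6 (fun p : ℂ × (Fin n → ℂ) => ρ p.1 p.2)
      {p | p.1 ∈ Circ ∧ ρ p.1 p.2 ≠ 0}
  hR : 1 < R
  grad_ne : ∀ z ∈ Circ, ∀ w, 0 < ρ z w → ρ z w ≤ R → fderiv ℝ (ρ z) w ≠ 0
  hypo : StrictHypoconvexOn ρ {p | p.1 ∈ Circ ∧ ρ p.1 p.2 ≠ 0}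
  levelCompact : ∀ t : ℝ, 0 < t → t ≤ R →
      IsCompact {p : ℂ × (Fin n → ℂ) | p.1 ∈ Circ ∧ ρ p.1 p.2 = t}
  fiberSphere : ∀ t : ℝ, 0 < t → t ≤ R → ∀ z ∈ Circ,
      DiffeomorphicSets {w | ρ z w = t} (Metric.sphere (0 : EuclideanSpace ℂ (Fin n)) 1)
  levelR : ∀ z ∈ Circ, ∀ w, ρ z w = R ↔ euclNorm w = R
  aboveR : ∀ z ∈ Circ, ∀ w, R < euclNorm w → R < ρ z w
  Scont : ContinuousOn S Circ
  Ssmall : ∀ z ∈ Circ, euclNorm (S z) < R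
  Szero : ∀ z ∈ Circ, ∀ w, ρ z w = 0 ↔ w = S z

/-- The `j`-th Fourier coefficient of the boundary values of `f` on the circle. -/
def bCoeff (f : ℂ → ℂ) (j : ℤ) : ℂ :=
  (1 / (2 * Real.pi) : ℂ) * ∫ θ in (0:ℝ)..(2 * Real.pi),
    f (Complex.exp (↑θ * Complex.I)) * Complex.exp (-(j : ℂ) * ↑θ * Complex.I)

/-- The Hilbert space `ℓ²(ℤ)` used to represent `W^{1,2}(Γ)`. -/
abbrev Seq2 : Type := lp (fun _ : ℤ => ℂ) 2

/-- `a ∈ ℓ²(ℤ)` is the (weighted) Fourier coefficient representation of `f` in the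
Sobolev space `W^{1,2}(Γ)`; the weight `√(1+j²)` makes the `ℓ²` norm of `a`
equivalent to the `W^{1,2}` norm of `f`. -/
def RepOf (a : Seq2) (f : ℂ → ℂ) : Prop :=
  ∀ j : ℤ, (a : ∀ _ : ℤ, ℂ) j = (Real.sqrt (1 + (j:ℝ)^2) : ℂ) * bCoeff f j

/-- Membership in `H^{1,2}(Δ) = H²(Δ) ∩ W^{1,2}(Γ)` (whose elements extend
continuously to the closed disk). -/
def MemH12 (f : ℂ → ℂ) : Prop :=
  ContinuousOn f Disk ∧ DifferentiableOn ℂ f (Metric.ball (0:ℂ) 1) ∧ ∃ a : Seq2, RepOf a f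

/-- Membership in the disk algebra `A(Δ)`. -/
def MemA (f : ℂ → ℂ) : Prop :=
  ContinuousOn f Disk ∧ DifferentiableOn ℂ f (Metric.ball (0:ℂ) 1)

/-- Membership in `H^∞(Δ)`. -/
def MemHinf (f : ℂ → ℂ) : Prop :=
  DifferentiableOn ℂ f (Metric.ball (0:ℂ) 1) ∧ ∃ M : ℝ, ∀ z ∈ Metric.ball (0:ℂ) 1, ‖f z‖ ≤ M

/-- `f` is `C^k`-smooth on the circle `Γ`. -/
def CkCirc (k : ℕ) (f : ℂ → ℂ) : Prop :=
  ContDiff ℝ k (fun θ : ℝ => f (Complex.exp (↑θ * Complex.I)))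

/-- `f` is `C⁴`-smooth on the circle `Γ`. -/
def C4Circ (f : ℂ → ℂ) : Prop := CkCirc 4 f

/-- Vector-valued versions. -/
def MemH12V {n : ℕ} (f : ℂ → Fin n → ℂ) : Prop := ∀ j, MemH12 fun z => f z j
def MemAV {n : ℕ} (f : ℂ → Fin n → ℂ) : Prop := ∀ j, MemA fun z => f z j
def MemHinfV {n : ℕ} (f : ℂ → Fin n → ℂ) : Prop := ∀ j, MemHinf fun z => f z j
def C4CircV {n : ℕ} (f : ℂ → Fin n → ℂ) : Prop := ∀ j, C4Circ fun z => f z j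

/-- The coordinates of a point of `ℂ × ℂⁿ` as a point of `ℂ^{n+1}`. -/
def pcoords {n : ℕ} (p : ℂ × (Fin n → ℂ)) : Fin (n+1) → ℂ := Fin.cons p.1 p.2

/-- The polynomial hull of a subset of `ℂ × ℂⁿ ≅ ℂ^{n+1}`. -/
def polyHull {n : ℕ} (Y : Set (ℂ × (Fin n → ℂ))) : Set (ℂ × (Fin n → ℂ)) :=
  {p | ∀ P : MvPolynomial (Fin (n+1)) ℂ, ∀ M : ℝ,
    (∀ q ∈ Y, ‖MvPolynomial.eval (pcoords q) P‖ ≤ M) → ‖MvPolynomial.eval (pcoords p) P‖ ≤ M}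

/-- The polynomial hull of a subset of `ℂⁿ`. -/
def polyHulln {n : ℕ} (Y : Set (Fin n → ℂ)) : Set (Fin n → ℂ) :=
  {w | ∀ P : MvPolynomial (Fin n) ℂ, ∀ M : ℝ,
    (∀ v ∈ Y, ‖MvPolynomial.eval v P‖ ≤ M) → ‖MvPolynomial.eval w P‖ ≤ M}

/-- The coordinates of a point of `ℂ × ℂⁿ × ℂⁿ` as a point of `ℂ^{2n+1}`. -/
def pcoords2 {n : ℕ} (p : ℂ × ((Fin n → ℂ) × (Fin n → ℂ))) : Fin (n + n + 1) → ℂ :=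
  Fin.cons p.1 (Fin.append p.2.1 p.2.2)

/-- The polynomial hull of a subset of `ℂ × ℂⁿ × ℂⁿ ≅ ℂ^{2n+1}`. -/
def polyHull2 {n : ℕ} (Y : Set (ℂ × ((Fin n → ℂ) × (Fin n → ℂ)))) :
    Set (ℂ × ((Fin n → ℂ) × (Fin n → ℂ))) :=
  {p | ∀ P : MvPolynomial (Fin (n + n + 1)) ℂ, ∀ M : ℝ,
    (∀ q ∈ Y, ‖MvPolynomial.eval (pcoords2 q) P‖ ≤ M) → ‖MvPolynomial.eval (pcoords2 p) P‖ ≤ M}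

/-- A subset of `ℂⁿ` is hypoconvex if its complement is a union of complex affine
hyperplanes. -/
def HypoconvexSet {n : ℕ} (A : Set (Fin n → ℂ)) : Prop :=
  ∀ v : Fin n → ℂ, v ∉ A → ∃ (c : Fin n → ℂ) (d : ℂ), c ≠ 0 ∧
    (∑ j, c j * v j) = d ∧ ∀ w ∈ A, (∑ j, c j * w j) ≠ d

/-- `A` has `C^k` boundary: near each boundary point the boundary is the zero set of a
`C^k` function with nonvanishing gradient. -/
def CkBoundary {E : Type*} [NormedAddCommGroup E] [NormedSpace ℝ E] (k : ℕ) (A : Set E) : Prop :=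
  ∀ p ∈ frontier A, ∃ U : Set E, IsOpen U ∧ p ∈ U ∧
    ∃ φ : E → ℝ, ContDiffOn ℝ k φ U ∧ (∀ x ∈ U, fderiv ℝ φ x ≠ 0) ∧
      frontier A ∩ U = {x | φ x = 0} ∩ U

/-- `fb` gives the a.e. radial boundary values on `Γ` of the function `f` on the open disk. -/
def IsBdryVal {n : ℕ} (f fb : ℂ → Fin n → ℂ) : Prop :=
  ∀ᵐ (θ : ℝ) ∂(volume.restrict (Set.Ioc (0:ℝ) (2 * Real.pi))),
    Filter.Tendsto (fun r : ℝ => f ((r : ℂ) * Complex.exp (↑θ * Complex.I)))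
      (nhdsWithin 1 (Set.Iio 1)) (nhds (fb (Complex.exp (↑θ * Complex.I))))

/-- The optimal control `γ_ρ = inf_{f ∈ H^∞(Δ)ⁿ} ess sup_{z ∈ Γ} ρ(z,f(z))`. -/
def gammaRho {n : ℕ} (ρ : ℂ → (Fin n → ℂ) → ℝ) : ℝ :=
  sInf {c : ℝ | ∃ f fb : ℂ → Fin n → ℂ, MemHinfV f ∧ IsBdryVal f fb ∧
    ∀ᵐ (θ : ℝ) ∂(volume.restrict (Set.Ioc (0:ℝ) (2 * Real.pi))),
      ρ (Complex.exp (↑θ * Complex.I)) (fb (Complex.exp (↑θ * Complex.I))) ≤ c}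

/-- `δ_ρ = inf_{f ∈ A(Δ)ⁿ} sup_{z ∈ Γ} ρ(z,f(z))`. -/
def deltaRho {n : ℕ} (ρ : ℂ → (Fin n → ℂ) → ℝ) : ℝ :=
  sInf {c : ℝ | ∃ f : ℂ → Fin n → ℂ, MemAV f ∧ ∀ z ∈ Circ, ρ z (f z) ≤ c}

/-- `ρ_m(z,w) = ρ(z, w/zᵐ)`. -/
def rhoShift {n : ℕ} (ρ : ℂ → (Fin n → ℂ) → ℝ) (m : ℕ) : ℂ → (Fin n → ℂ) → ℝ :=
  fun z w => ρ z (fun j => w j / z ^ m)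

/-- `q` is an `n`-tuple of harmonic polynomials. -/
def HarmPolyTuple {n : ℕ} (q : ℂ → Fin n → ℂ) : Prop :=
  ∃ (d : ℕ) (a b : ℕ → Fin n → ℂ), ∀ z : ℂ, ∀ j,
    q z j = ∑ i ∈ Finset.range (d+1), (a i j * z ^ i + b i j * (starRingEnd ℂ z) ^ i)

/-- `zᵐ q(z)` has analytic polynomial coordinates (as boundary values on `Γ`). -/
def ZmAnalytic {n : ℕ} (m : ℕ) (q : ℂ → Fin n → ℂ) : Prop :=
  ∀ j, ∃ p : Polynomial ℂ, ∀ z ∈ Circ, z ^ m * q z j = Polynomial.eval z p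

/-- The boundary function `q` on `Γ` is analytic, i.e. agrees on `Γ` with an element
of `A(Δ)ⁿ`. -/
def BoundaryAnalytic {n : ℕ} (q : ℂ → Fin n → ℂ) : Prop :=
  ∃ h : ℂ → Fin n → ℂ, MemAV h ∧ ∀ z ∈ Circ, h z = q z

/-- The (squared) `W^{1,2}(Γ)` norm of `f`, via Fourier coefficients:
`C‖f‖₂² + ‖f_θ‖₂²`. -/
def w12NormSq (Cc : ℝ) (f : ℂ → ℂ) : ℝ :=
  Cc * (∑' j : ℤ, ‖bCoeff f j‖^2) + ∑' j : ℤ, (j:ℝ)^2 * ‖bCoeff f j‖^2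

def w12Norm (Cc : ℝ) (f : ℂ → ℂ) : ℝ := Real.sqrt (w12NormSq Cc f)

def w12VNorm {n : ℕ} (Cc : ℝ) (f : ℂ → Fin n → ℂ) : ℝ :=
  Real.sqrt (∑ j, w12NormSq Cc (fun z => f z j))

/-- Membership in `W^{1,2}(Γ)` (continuous representatives). -/
def MemW12 (f : ℂ → ℂ) : Prop := ContinuousOn f Circ ∧ ∃ a : Seq2, RepOf a f

def MemW12V {n : ℕ} (f : ℂ → Fin n → ℂ) : Prop := ∀ j, MemW12 fun z => f z j

/-- Parametrisation of the circle. -/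
def ee (θ : ℝ) : ℂ := Complex.exp (↑θ * Complex.I)

lemma ee_add (s t : ℝ) : ee (s + t) = ee s * ee t := by
  simp [ee, add_mul, Complex.exp_add]

lemma ee_per (s : ℝ) : ee (s + 2 * Real.pi) = ee s := by
  rw [ee_add]; simp [ee, Complex.exp_two_pi_mul_I]

lemma ee_cont : Continuous ee := by unfold ee; fun_prop

lemma ee_mem (t : ℝ) : ee t ∈ Circ := by
  simp [ee, Circ, Complex.norm_exp_ofReal_mul_I]

lemma ee_arg {z : ℂ} (hz : z ∈ Circ) : ee z.arg = z := by
  have h : ‖z‖ = 1 := by simpa [Circ] using hz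
  have := Complex.norm_mul_exp_arg_mul_I z
  rw [h] at this
  simpa [ee] using this

lemma contOn_circ {u : ℂ → ℂ} : ContinuousOn u Circ ↔ Continuous (fun θ => u (ee θ)) := by
  constructor
  · intro h
    exact h.comp_continuous ee_cont ee_mem
  · intro h z hz
    have hz0 : z ≠ 0 := by
      rintro rfl; simp [Circ] at hz
    have e1 : ∀ y ∈ Circ, ee (z.arg + (y / z).arg) = y := by
      intro y hy
      rw [ee_add, ee_arg hz, ee_arg]
      · field_simp
      · simp [Circ] at hz hy ⊢; simp [hz, hy]
    have hc : ContinuousAt (fun y => u (ee (z.arg + (y / z).arg))) z := by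
      have h1 : ContinuousAt (fun y : ℂ => z.arg + (y / z).arg) z := by
        apply ContinuousAt.add continuousAt_const
        apply ContinuousAt.comp (g := Complex.arg) (f := fun y => y / z)
        · apply Complex.continuousAt_arg
          rw [div_self hz0]; simp
        · fun_prop
      exact ContinuousAt.comp (g := fun θ => u (ee θ)) h.continuousAt h1
    refine (hc.continuousWithinAt (s := Circ)).congr ?_ ?_
    · intro y hy; rw [e1 y hy]
    · rw [e1 z hz]

lemma bCoeff_eq (u : ℂ → ℂ) (j : ℤ) :
    bCoeff u j = fourierCoeffOn Real.two_pi_pos (fun θ => u (ee θ)) j := by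
  rw [fourierCoeffOn_eq_integral]
  unfold bCoeff
  rw [sub_zero, Complex.real_smul]
  congr 1
  · push_cast; rfl
  · apply intervalIntegral.integral_congr
    intro θ _
    simp only [fourier_coe_apply, smul_eq_mul]
    rw [mul_comm]
    congr 2
    have : (Real.pi : ℂ) ≠ 0 := by exact_mod_cast Real.pi_ne_zero
    push_cast
    field_simp

lemma parseval {u : ℂ → ℂ} (hu : Continuous (fun θ => u (ee θ))) :
    HasSum (fun j => ‖bCoeff u j‖ ^ 2)
      ((2 * Real.pi)⁻¹ * ∫ θ in (0:ℝ)..(2 * Real.pi), ‖u (ee θ)‖ ^ 2) := by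
  have := hasSum_sq_fourierCoeffOn (f := fun θ => u (ee θ)) Real.two_pi_pos (by
    have h1 := (memLp_top_of_bound (μ := volume.restrict (Ioc (0:ℝ) (2*Real.pi)))
      (f := fun θ => u (ee θ)) hu.aestronglyMeasurable.restrict)
    obtain ⟨B, hB⟩ := (isCompact_Icc (a := (0:ℝ)) (b := 2 * Real.pi)).exists_bound_of_continuousOn hu.continuousOn
    exact (h1 B ((ae_restrict_iff' measurableSet_Ioc).2 (Eventually.of_forall
      fun x hx => hB x (Ioc_subset_Icc_self hx)))).mono_exponent le_top)
  simpa [bCoeff_eq] using this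

lemma bCoeff_sub {u v : ℂ → ℂ} (hu : Continuous (fun θ => u (ee θ)))
    (hv : Continuous (fun θ => v (ee θ))) (j : ℤ) :
    bCoeff (fun z => u z - v z) j = bCoeff u j - bCoeff v j := by
  unfold bCoeff
  rw [← mul_sub, ← intervalIntegral.integral_sub]
  · simp_rw [sub_mul]
  · apply Continuous.intervalIntegrable
    exact hu.mul (by fun_prop)
  · apply Continuous.intervalIntegrable
    exact hv.mul (by fun_prop)

lemma bCoeff_shift (u : ℂ → ℂ) (t : ℝ) (j : ℤ) :
    bCoeff (fun z => u (ee t * z)) j = ee (j * t) * bCoeff u j := by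
  unfold bCoeff
  rw [mul_left_comm]
  congr 1
  rw [← intervalIntegral.integral_const_mul]
  set F : ℝ → ℂ := fun θ => ee (j * t) * (u (ee θ) * Complex.exp (-(j : ℂ) * θ * Complex.I)) with hF
  have hper : Function.Periodic F (2 * Real.pi) := by
    intro θ
    simp only [hF, ee_per]
    congr 2
    have : (-(j : ℂ) * ((θ + 2 * Real.pi : ℝ) : ℂ) * Complex.I)
      = -(j : ℂ) * θ * Complex.I + ((-j : ℤ) : ℂ) * (2 * Real.pi * Complex.I) := by
      push_cast; ring
    rw [this, Complex.exp_add, Complex.exp_int_mul_two_pi_mul_I, mul_one]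
  have h1 : ∀ θ : ℝ, u (ee t * Complex.exp (θ * Complex.I)) * Complex.exp (-(j : ℂ) * θ * Complex.I)
      = F (θ + t) := by
    intro θ
    simp only [hF]
    rw [add_comm θ t, ee_add]
    rw [mul_left_comm]
    congr 1
    unfold ee
    rw [← Complex.exp_add]
    congr 1
    push_cast; ring
  simp_rw [h1]
  rw [intervalIntegral.integral_comp_add_right]
  have := hper.intervalIntegral_add_eq (0 + t) 0
  rw [zero_add] at this ⊢
  rw [add_comm, this, zero_add]
  rfl

lemma parseval_shift {u : ℂ → ℂ} (hu : Continuous (fun θ => u (ee θ))) (t : ℝ) :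
    HasSum (fun j : ℤ => ‖ee (j * t) - 1‖ ^ 2 * ‖bCoeff u j‖ ^ 2)
      ((2 * Real.pi)⁻¹ * ∫ θ in (0:ℝ)..(2 * Real.pi), ‖u (ee (θ + t)) - u (ee θ)‖ ^ 2) := by
  have h1 : Continuous (fun θ => u (ee t * ee θ)) := by
    have : (fun θ => u (ee t * ee θ)) = (fun θ => u (ee θ)) ∘ (fun θ => t + θ) := by
      ext θ; simp [ee_add]
    rw [this]; exact hu.comp (by fun_prop)
  have := parseval (u := fun z => u (ee t * z) - u z) (h1.sub hu)
  convert! this using 1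
  · ext j
    rw [bCoeff_sub (u := fun z => u (ee t * z)) h1 hu, bCoeff_shift, ← sub_one_mul, norm_mul, mul_pow]
  · simp_rw [add_comm _ t, ee_add]

/-- the squared norm of derivative -/
def dsq (u : ℂ → ℂ) : ℝ := ∑' j : ℤ, (j:ℝ)^2 * ‖bCoeff u j‖^2

lemma dsq_nonneg (u : ℂ → ℂ) : 0 ≤ dsq u := tsum_nonneg fun j => by positivity

lemma memW12_iff {u : ℂ → ℂ} : MemW12 u ↔ Continuous (fun θ => u (ee θ)) ∧
    Summable (fun j : ℤ => (j:ℝ)^2 * ‖bCoeff u j‖^2) := by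
  unfold MemW12
  rw [contOn_circ]
  refine and_congr_right fun hu => ?_
  have hs := (parseval hu).summable
  have e : ∀ j : ℤ, ‖(Real.sqrt (1 + (j:ℝ)^2) : ℂ) * bCoeff u j‖ ^ 2
      = ‖bCoeff u j‖ ^ 2 + (j:ℝ)^2 * ‖bCoeff u j‖^2 := by
    intro j
    rw [norm_mul, mul_pow, Complex.norm_real, Real.norm_eq_abs, sq_abs, Real.sq_sqrt (by positivity)]
    ring
  constructor
  · rintro ⟨a, ha⟩
    have h := (lp.memℓp a).summable (by norm_num)
    have h2 : Summable (fun j : ℤ => ‖bCoeff u j‖ ^ 2 + (j:ℝ)^2 * ‖bCoeff u j‖^2) := by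
      refine h.congr fun j => ?_
      rw [← e, ← ha j]
      norm_num
    exact (h2.sub hs).congr fun j => by ring
  · intro h
    refine ⟨⟨fun j => (Real.sqrt (1 + (j:ℝ)^2) : ℂ) * bCoeff u j, ?_⟩, fun j => rfl⟩
    apply memℓp_gen
    refine (hs.add h).congr fun j => ?_
    rw [← e]
    norm_num

lemma norm_ee_sub_one_le (x : ℝ) : ‖ee x - 1‖ ≤ |x| := by
  have := Real.norm_exp_I_mul_ofReal_sub_one_le (x := x)
  rw [mul_comm] at this
  simpa [ee] using this

lemma shift_upper {u : ℂ → ℂ} (hu : MemW12 u) (t : ℝ) :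
    (2 * Real.pi)⁻¹ * ∫ θ in (0:ℝ)..(2 * Real.pi), ‖u (ee (θ + t)) - u (ee θ)‖ ^ 2
      ≤ t ^ 2 * dsq u := by
  obtain ⟨h1, h2⟩ := memW12_iff.1 hu
  refine hasSum_le (fun j => ?_) (parseval_shift h1 t) (h2.hasSum.mul_left (t^2))
  have := norm_ee_sub_one_le (j * t)
  have h3 : ‖ee (j * t) - 1‖ ^ 2 ≤ (j * t) ^ 2 := by
    rw [← sq_abs (_ * t)]; gcongr
  calc _ ≤ (j * t)^2 * ‖bCoeff u j‖ ^ 2 := by gcongr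
    _ = _ := by ring

lemma tendsto_ee (j : ℤ) : Tendsto (fun t : ℝ => ‖ee (j * t) - 1‖ ^ 2 / t ^ 2) (nhdsWithin 0 {0}ᶜ)
    (nhds ((j:ℝ)^2)) := by
  have h : HasDerivAt (fun t : ℝ => ee (j * t)) (j * Complex.I) 0 := by
    have h1 : HasDerivAt (fun t : ℝ => ((j * t : ℝ) : ℂ) * Complex.I) (j * Complex.I) 0 := by
      have : HasDerivAt (fun t : ℝ => (j * t : ℝ)) (j : ℝ) 0 := by
        simpa using (hasDerivAt_id (0:ℝ)).const_mul (j : ℝ)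
      simpa using this.ofReal_comp.mul_const Complex.I
    simpa [ee] using h1.cexp
  have h2 := (hasDerivAt_iff_tendsto_slope.1 h).norm.pow 2
  have e : ‖(j:ℂ) * Complex.I‖ ^ 2 = (j:ℝ)^2 := by simp
  rw [e] at h2
  refine h2.congr fun t => ?_
  simp [slope, mul_pow, div_eq_inv_mul]
  left; simp [ee]

lemma shift_lower {u : ℂ → ℂ} (hu : Continuous (fun θ => u (ee θ))) (K : ℝ)
    (h : ∀ t : ℝ, |t| ≤ 1 →
      (2 * Real.pi)⁻¹ * ∫ θ in (0:ℝ)..(2 * Real.pi), ‖u (ee (θ + t)) - u (ee θ)‖ ^ 2 ≤ t ^ 2 * K) :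
    MemW12 u ∧ dsq u ≤ K := by
  have key : ∀ s : Finset ℤ, ∑ j ∈ s, (j:ℝ)^2 * ‖bCoeff u j‖^2 ≤ K := by
    intro s
    have ht : Tendsto (fun t : ℝ => ∑ j ∈ s, ‖ee (j * t) - 1‖ ^ 2 / t ^ 2 * ‖bCoeff u j‖^2)
      (nhdsWithin 0 {0}ᶜ) (nhds (∑ j ∈ s, (j:ℝ)^2 * ‖bCoeff u j‖^2)) :=
      tendsto_finsetSum _ fun j _ => (tendsto_ee j).mul_const _
    refine le_of_tendsto ht ?_
    have h1 : ∀ᶠ t : ℝ in nhdsWithin 0 {0}ᶜ, |t| ≤ 1 := by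
      apply mem_nhdsWithin_of_mem_nhds
      filter_upwards [Metric.closedBall_mem_nhds (0:ℝ) one_pos] with t ht
      simpa using ht
    filter_upwards [h1, self_mem_nhdsWithin] with t ht ht0
    have ht0 : 0 < t ^ 2 := by
      have : t ≠ 0 := ht0
      positivity
    have h2 := (sum_le_hasSum s (fun j _ => by positivity) (parseval_shift hu t)).trans (h t ht)
    have : ∑ j ∈ s, ‖ee (j * t) - 1‖ ^ 2 / t ^ 2 * ‖bCoeff u j‖^2
      = (∑ j ∈ s, ‖ee (j * t) - 1‖ ^ 2 * ‖bCoeff u j‖^2) / t ^ 2 := by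
      rw [Finset.sum_div]; exact Finset.sum_congr rfl fun j _ => by ring
    rw [this, div_le_iff₀ ht0, mul_comm K]
    exact h2
  have hs := summable_of_sum_le (f := fun j : ℤ => (j:ℝ)^2 * ‖bCoeff u j‖^2) (fun j => by positivity) key
  exact ⟨memW12_iff.2 ⟨hu, hs⟩, hs.tsum_le_of_sum_le key⟩

lemma w12NormSq_le {u : ℂ → ℂ} (hu : Continuous (fun θ => u (ee θ))) {Cc m : ℝ} (hC : 0 < Cc)
    (hm : ∀ θ ∈ Icc (0:ℝ) (2 * Real.pi), ‖u (ee θ)‖ ≤ m) : w12NormSq Cc u ≤ Cc * m ^ 2 + dsq u := by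
  unfold w12NormSq dsq
  gcongr
  rw [(parseval hu).tsum_eq]
  have : ∫ θ in (0:ℝ)..(2 * Real.pi), ‖u (ee θ)‖ ^ 2 ≤ ∫ θ in (0:ℝ)..(2 * Real.pi), m ^ 2 := by
    apply intervalIntegral.integral_mono_on Real.two_pi_pos.le
    · exact (hu.norm.pow 2).intervalIntegrable _ _
    · simp
    · intro θ hθ
      have := hm θ hθ
      gcongr
  rw [intervalIntegral.integral_const, smul_eq_mul, sub_zero] at this
  rw [inv_mul_le_iff₀ Real.two_pi_pos]
  exact this

lemma sobolev (Cc : ℝ) (hC : 0 < Cc) : ∃ K : ℝ, 0 < K ∧ ∀ u : ℂ → ℂ, MemW12 u →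
    ∀ θ, ‖u (ee θ)‖ ^ 2 ≤ K ^ 2 * w12NormSq Cc u := by
  have hsum : Summable (fun j : ℤ => (1 : ℝ) / (Cc + (j:ℝ)^2)) := by
    have h0 : Summable (fun j : ℤ => (1 : ℝ) / (j:ℝ)^2) :=
      Real.summable_one_div_int_pow.2 (by norm_num)
    refine Summable.of_norm_bounded_eventually (g := fun j : ℤ => (1 : ℝ) / (j:ℝ)^2) h0 ?_
    have : {(0:ℤ)}ᶜ ∈ (cofinite : Filter ℤ) := (Set.finite_singleton 0).compl_mem_cofinite
    filter_upwards [this] with j hj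
    have hj : (j:ℝ) ≠ 0 := by exact_mod_cast hj
    rw [Real.norm_of_nonneg (by positivity)]
    gcongr
    linarith
  set S := ∑' j : ℤ, (1 : ℝ) / (Cc + (j:ℝ)^2) with hS
  have hS0 : 0 ≤ S := tsum_nonneg fun j => by positivity
  refine ⟨Real.sqrt (S + 1), by positivity, fun u hu θ => ?_⟩
  obtain ⟨h1, h2⟩ := memW12_iff.1 hu
  have hw : HasSum (fun j : ℤ => (Cc + (j:ℝ)^2) * ‖bCoeff u j‖ ^ 2) (w12NormSq Cc u) := by
    have := ((parseval h1).summable.hasSum.mul_left Cc).add h2.hasSum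
    simp_rw [← add_mul] at this
    exact this
  have hN0 : 0 ≤ w12NormSq Cc u := hw.nonneg fun j => by positivity
  -- finite Cauchy Schwarz
  have hcs : ∀ s : Finset ℤ, ∑ j ∈ s, ‖bCoeff u j‖ ≤ Real.sqrt (S * w12NormSq Cc u) := by
    intro s
    apply Real.le_sqrt_of_sq_le
    have := Finset.sum_mul_sq_le_sq_mul_sq s (fun j : ℤ => (Real.sqrt (Cc + (j:ℝ)^2))⁻¹)
      (fun j => Real.sqrt (Cc + (j:ℝ)^2) * ‖bCoeff u j‖)
    have e1 : ∀ j : ℤ, (Real.sqrt (Cc + (j:ℝ)^2))⁻¹ * (Real.sqrt (Cc + (j:ℝ)^2) * ‖bCoeff u j‖)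
        = ‖bCoeff u j‖ := by
      intro j
      have : 0 < Real.sqrt (Cc + (j:ℝ)^2) := by positivity
      field_simp
    have e2 : ∀ j : ℤ, (Real.sqrt (Cc + (j:ℝ)^2))⁻¹ ^ 2 = 1 / (Cc + (j:ℝ)^2) := by
      intro j; rw [inv_pow, Real.sq_sqrt (by positivity), one_div]
    have e3 : ∀ j : ℤ, (Real.sqrt (Cc + (j:ℝ)^2) * ‖bCoeff u j‖) ^ 2
        = (Cc + (j:ℝ)^2) * ‖bCoeff u j‖ ^ 2 := by
      intro j; rw [mul_pow, Real.sq_sqrt (by positivity)]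
    simp_rw [e1, e2, e3] at this
    refine this.trans ?_
    gcongr
    · exact hsum.sum_le_tsum s fun j _ => by positivity
    · exact sum_le_hasSum s (fun j _ => by positivity) hw
  have hsn : Summable (fun j : ℤ => ‖bCoeff u j‖) := summable_of_sum_le (fun j => norm_nonneg _) hcs
  have htn := hsn.tsum_le_of_sum_le hcs
  have : Fact (0 < 2 * Real.pi) := ⟨Real.two_pi_pos⟩
  have hper : Function.Periodic (fun θ => u (ee θ)) (2 * Real.pi) := fun θ => by simp only [ee_per]
  let g : C(AddCircle (2 * Real.pi), ℂ) := ⟨hper.lift, by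
    apply continuous_coinduced_dom.2
    exact h1⟩
  have hg : ∀ j, fourierCoeff g j = bCoeff u j := by
    intro j
    rw [bCoeff_eq, fourierCoeff_eq_intervalIntegral _ _ 0, fourierCoeffOn_eq_integral, zero_add, sub_zero]
    rfl
  have hps := has_pointwise_sum_fourier_series_of_summable (f := g)
    (by simp_rw [funext hg]; exact hsn.of_norm) (θ : AddCircle (2 * Real.pi))
  have hgv : g (θ : AddCircle (2 * Real.pi)) = u (ee θ) := rfl
  rw [hgv] at hps
  have hle : ‖u (ee θ)‖ ≤ ∑' j, ‖bCoeff u j‖ := by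
    rw [← hps.tsum_eq]
    have en : ∀ j, ‖fourierCoeff g j • fourier j (θ : AddCircle (2 * Real.pi))‖ = ‖bCoeff u j‖ := by
      intro j
      rw [norm_smul, hg, fourier_apply, Circle.norm_coe, mul_one]
    refine (norm_tsum_le_tsum_norm ?_).trans ?_
    · simp_rw [en]; exact hsn
    · simp_rw [en]; exact le_rfl
  calc ‖u (ee θ)‖ ^ 2 ≤ (Real.sqrt (S * w12NormSq Cc u)) ^ 2 := by gcongr; exact hle.trans htn
    _ = S * w12NormSq Cc u := Real.sq_sqrt (by positivity)
    _ ≤ (S + 1) * w12NormSq Cc u := by gcongr; linarith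
    _ = _ := by rw [Real.sq_sqrt (by positivity)]

section abstractCalculus

variable {X Y : Type*} [NormedAddCommGroup X] [NormedSpace ℝ X] [ProperSpace X]
  [NormedAddCommGroup Y] [NormedSpace ℝ Y]

lemma lip_ball {Φ : X → Y} (h : ContDiff ℝ 1 Φ) (R : ℝ) : ∃ L : ℝ, 0 ≤ L ∧
    ∀ x ∈ closedBall (0:X) R, ∀ x' ∈ closedBall (0:X) R, ‖Φ x' - Φ x‖ ≤ L * ‖x' - x‖ := by
  obtain ⟨B, hB⟩ := (isCompact_closedBall (0:X) R).exists_bound_of_continuousOn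
    (h.continuous_fderiv one_ne_zero).continuousOn
  refine ⟨max B 0, le_max_right _ _, fun x hx x' hx' => ?_⟩
  exact (convex_closedBall (0:X) R).norm_image_sub_le_of_norm_fderiv_le
    (fun y _ => (h.differentiable one_ne_zero) y) (fun y hy => (hB y hy).trans (le_max_left _ _)) hx hx'

lemma second_ball {Φ : X → Y} (h : ContDiff ℝ 2 Φ) (R : ℝ) : ∃ L : ℝ, 0 ≤ L ∧
    ∀ x ∈ closedBall (0:X) R, ∀ x' ∈ closedBall (0:X) R,
    ∀ k ∈ closedBall (0:X) R, ∀ k' ∈ closedBall (0:X) R,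
      ‖(Φ (x' + k') - Φ x') - (Φ (x + k) - Φ x)‖ ≤ L * (‖k‖ * ‖x' - x‖ + ‖k' - k‖) := by
  obtain ⟨L1, hL1, h1⟩ := lip_ball (h.of_le one_le_two) (R + R)
  obtain ⟨L2, hL2, h2⟩ := lip_ball (h.fderiv_right (m := 1) (by norm_num)) (R + R)
  have hadd : ∀ x ∈ closedBall (0:X) R, ∀ k ∈ closedBall (0:X) R, x + k ∈ closedBall (0:X) (R + R) := by
    intro x hx k hk
    simp only [mem_closedBall, dist_zero_right] at *
    exact (norm_add_le _ _).trans (add_le_add hx hk)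
  refine ⟨L1 + L2, by positivity, fun x hx x' hx' k hk k' hk' => ?_⟩
  have hR : 0 ≤ R := by
    have := dist_nonneg.trans (mem_closedBall.1 hx); exact this
  have hsub : closedBall (0:X) R ⊆ closedBall (0:X) (R + R) := closedBall_subset_closedBall (by linarith)
  have hd : Differentiable ℝ Φ := h.differentiable two_ne_zero
  have e1 : ‖Φ (x' + k') - Φ (x' + k)‖ ≤ L1 * ‖k' - k‖ := by
    have := h1 (x' + k) (hadd _ hx' _ hk) (x' + k') (hadd _ hx' _ hk')
    simpa using this
  have e2 : ‖(Φ (x' + k) - Φ x') - (Φ (x + k) - Φ x)‖ ≤ (L2 * ‖k‖) * ‖x' - x‖ := by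
    refine (convex_closedBall (0:X) R).norm_image_sub_le_of_norm_hasFDerivWithin_le
      (f := fun y => Φ (y + k) - Φ y) (f' := fun y => fderiv ℝ Φ (y + k) - fderiv ℝ Φ y) ?_ ?_ hx hx'
    · intro y hy
      have a : HasFDerivAt (fun y => Φ (y + k)) (fderiv ℝ Φ (y + k)) y := by
        exact (hasFDerivAt_comp_add_right k).2 (hd (y + k)).hasFDerivAt
      exact (a.sub (hd y).hasFDerivAt).hasFDerivWithinAt
    · intro y hy
      have := h2 y (hsub hy) (y + k) (hadd _ hy _ hk)
      simpa using this
  calc _ = ‖(Φ (x' + k') - Φ (x' + k)) + ((Φ (x' + k) - Φ x') - (Φ (x + k) - Φ x))‖ := by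
        congr 1; abel
    _ ≤ L1 * ‖k' - k‖ + (L2 * ‖k‖) * ‖x' - x‖ := (norm_add_le _ _).trans (add_le_add e1 e2)
    _ ≤ _ := by
      have := mul_nonneg hL2 (norm_nonneg (k' - k))
      have := mul_nonneg hL1 (mul_nonneg (norm_nonneg k) (norm_nonneg (x' - x)))
      linarith

lemma third_ball {G : X → ℝ} (h : ContDiff ℝ 3 G) (R : ℝ) : ∃ L : ℝ, 0 ≤ L ∧
    ∀ κ ≤ R, ∀ x ∈ closedBall (0:X) R, ∀ x' ∈ closedBall (0:X) R,
    ∀ k ∈ closedBall (0:X) κ, ∀ k' ∈ closedBall (0:X) κ,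
      |(G (x' + k') - G x' - fderiv ℝ G x' k') - (G (x + k) - G x - fderiv ℝ G x k)|
        ≤ L * (κ ^ 2 * ‖x' - x‖ + κ * ‖k' - k‖) ∧
      |G (x + k) - G x - fderiv ℝ G x k| ≤ L * κ ^ 2 := by
  obtain ⟨L1, hL1, h1⟩ := second_ball (h.fderiv_right (m := 2) (by norm_num)) R
  have hd : Differentiable ℝ G := h.differentiable three_ne_zero
  refine ⟨L1, hL1, fun κ hκR x hx x' hx' k hk k' hk' => ?_⟩
  have hκ : 0 ≤ κ := by
    have := dist_nonneg.trans (mem_closedBall.1 hk); exact this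
  have hsub : closedBall (0:X) κ ⊆ closedBall (0:X) R := closedBall_subset_closedBall hκR
  have h0R : (0:X) ∈ closedBall (0:X) R := by simp; linarith
  -- derivative in k
  have hder : ∀ x y : X, HasFDerivAt (fun k => G (x + k) - G x - fderiv ℝ G x k)
      (fderiv ℝ G (x + y) - fderiv ℝ G x) y := by
    intro x y
    have a : HasFDerivAt (fun y => G (x + y)) (fderiv ℝ G (x + y)) y :=
      (hasFDerivAt_comp_add_left x).2 (hd (x + y)).hasFDerivAt
    exact (a.sub_const (G x)).sub (fderiv ℝ G x).hasFDerivAt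
  have first : ∀ x ∈ closedBall (0:X) R, ∀ k ∈ closedBall (0:X) κ, ∀ k' ∈ closedBall (0:X) κ,
      |(G (x + k') - G x - fderiv ℝ G x k') - (G (x + k) - G x - fderiv ℝ G x k)|
        ≤ L1 * κ * ‖k' - k‖ := by
    intro x hx k hk k' hk'
    refine (convex_closedBall (0:X) κ).norm_image_sub_le_of_norm_hasFDerivWithin_le
      (f := fun k => G (x + k) - G x - fderiv ℝ G x k)
      (fun y hy => (hder x y).hasFDerivWithinAt) ?_ hk hk'
    intro y hy
    have := h1 x hx x hx 0 h0R y (hsub hy)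
    simp only [add_zero, sub_self, sub_zero, norm_zero, mul_zero, zero_add] at this
    refine this.trans ?_
    gcongr
    simpa using hy
  have second : |(G (x' + k) - G x' - fderiv ℝ G x' k) - (G (x + k) - G x - fderiv ℝ G x k)|
        ≤ L1 * κ ^ 2 * ‖x' - x‖ := by
    have hm := (convex_closedBall (0:X) κ).norm_image_sub_le_of_norm_hasFDerivWithin_le
      (f := fun k => (G (x' + k) - G x' - fderiv ℝ G x' k) - (G (x + k) - G x - fderiv ℝ G x k))
      (C := L1 * (κ * ‖x' - x‖)) (x := 0) (y := k)
      (fun y hy => ((hder x' y).sub (hder x y)).hasFDerivWithinAt) ?_ (by simpa using hκ) hk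
    · simp only [add_zero, sub_self, map_zero, sub_zero] at hm
      rw [Real.norm_eq_abs] at hm
      refine hm.trans ?_
      have : ‖k‖ ≤ κ := by simpa using hk
      calc L1 * (κ * ‖x' - x‖) * ‖k‖ ≤ L1 * (κ * ‖x' - x‖) * κ := by gcongr
        _ = _ := by ring
    · intro y hy
      have := h1 x hx x' hx' y (hsub hy) y (hsub hy)
      simp only [sub_self, norm_zero, add_zero] at this
      refine this.trans ?_
      gcongr
      simpa using hy
  constructor
  · have := first x' hx' k hk k' hk'
    have := abs_sub_le (G (x' + k') - G x' - fderiv ℝ G x' k') (G (x' + k) - G x' - fderiv ℝ G x' k)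
      (G (x + k) - G x - fderiv ℝ G x k)
    linarith
  · have := first x hx 0 (by simpa using hκ) k hk
    simp only [add_zero, sub_self, map_zero, sub_zero] at this
    refine this.trans ?_
    have : ‖k‖ ≤ κ := by simpa using hk
    calc L1 * κ * ‖k‖ ≤ L1 * κ * κ := by gcongr
      _ = _ := by ring

end abstractCalculus

section master
variable {n : ℕ}

/-- sum of squared derivative norms -/
def dsqV (f : ℂ → Fin n → ℂ) : ℝ := ∑ i, dsq (fun z => f z i)

lemma dsqV_nonneg (f : ℂ → Fin n → ℂ) : 0 ≤ dsqV f := Finset.sum_nonneg fun i _ => dsq_nonneg _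

lemma memV_cont {f : ℂ → Fin n → ℂ} (hf : MemW12V f) : Continuous (fun θ => f (ee θ)) :=
  continuous_pi fun i => (memW12_iff.1 (hf i)).1

lemma norm_sq_le_sum (w : Fin n → ℂ) : ‖w‖ ^ 2 ≤ ∑ i, ‖w i‖ ^ 2 := by
  have h0 : 0 ≤ ∑ i, ‖w i‖ ^ 2 := Finset.sum_nonneg fun _ _ => by positivity
  have : ‖w‖ ≤ Real.sqrt (∑ i, ‖w i‖ ^ 2) := by
    rw [pi_norm_le_iff_of_nonneg (Real.sqrt_nonneg _)]
    intro i
    apply Real.le_sqrt_of_sq_le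
    exact Finset.single_le_sum (f := fun i => ‖w i‖ ^ 2) (fun i _ => by positivity) (Finset.mem_univ i)
  calc ‖w‖ ^ 2 ≤ Real.sqrt (∑ i, ‖w i‖ ^ 2) ^ 2 := by gcongr
    _ = _ := Real.sq_sqrt h0

lemma shift_upperV {f : ℂ → Fin n → ℂ} (hf : MemW12V f) (t : ℝ) :
    (2 * Real.pi)⁻¹ * ∫ θ in (0:ℝ)..(2 * Real.pi), ‖f (ee (θ + t)) - f (ee θ)‖ ^ 2
      ≤ t ^ 2 * dsqV f := by
  have hc := memV_cont hf
  have hci : ∀ i, Continuous (fun θ => f (ee θ) i) := fun i => (memW12_iff.1 (hf i)).1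
  have hi : ∀ i, Continuous (fun θ => ‖f (ee (θ + t)) i - f (ee θ) i‖ ^ 2) := fun i =>
    (((hci i).comp (continuous_add_const t)).sub (hci i)).norm.pow 2
  have h1 : ∫ θ in (0:ℝ)..(2 * Real.pi), ‖f (ee (θ + t)) - f (ee θ)‖ ^ 2
     ≤ ∫ θ in (0:ℝ)..(2 * Real.pi), ∑ i, ‖f (ee (θ + t)) i - f (ee θ) i‖ ^ 2 := by
    apply intervalIntegral.integral_mono_on Real.two_pi_pos.le
    · exact (((hc.comp (continuous_add_const t)).sub hc).norm.pow 2).intervalIntegrable _ _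
    · exact (continuous_finsetSum _ fun i _ => hi i).intervalIntegrable _ _
    · intro θ _
      exact norm_sq_le_sum (f (ee (θ + t)) - f (ee θ))
  rw [intervalIntegral.integral_finsetSum (fun i _ => (hi i).intervalIntegrable _ _)] at h1
  calc _ ≤ (2 * Real.pi)⁻¹ * ∑ i, ∫ θ in (0:ℝ)..(2 * Real.pi), ‖f (ee (θ + t)) i - f (ee θ) i‖ ^ 2 := by
        have := Real.two_pi_pos
        gcongr
    _ ≤ _ := by
      rw [Finset.mul_sum, dsqV, Finset.mul_sum]
      exact Finset.sum_le_sum fun i _ => shift_upper (hf i) t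

lemma four_sq (a b c d : ℝ) : (a + b + c + d) ^ 2 ≤ 4 * (a ^ 2 + b ^ 2 + c ^ 2 + d ^ 2) := by
  nlinarith [sq_nonneg (a - b), sq_nonneg (a - c), sq_nonneg (a - d), sq_nonneg (b - c),
    sq_nonneg (b - d), sq_nonneg (c - d)]

lemma master {f k h : ℂ → Fin n → ℂ} (hf : MemW12V f) (hk : MemW12V k) (hh : MemW12V h)
    {V : ℂ → ℂ} (hV : Continuous (fun θ => V (ee θ))) {Cc : ℝ} (hC : 0 < Cc) (m a b c d : ℝ)
    (hm : ∀ θ ∈ Icc (0:ℝ) (2 * Real.pi), ‖V (ee θ)‖ ≤ m)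
    (hdiff : ∀ θ ∈ Icc (0:ℝ) (2 * Real.pi), ∀ t, |t| ≤ 1 →
      ‖V (ee (θ + t)) - V (ee θ)‖ ≤ a * |t| + b * ‖f (ee (θ + t)) - f (ee θ)‖
        + c * ‖k (ee (θ + t)) - k (ee θ)‖ + d * ‖h (ee (θ + t)) - h (ee θ)‖) :
    MemW12 V ∧ w12NormSq Cc V ≤
      Cc * m ^ 2 + 4 * (a ^ 2 + b ^ 2 * dsqV f + c ^ 2 * dsqV k + d ^ 2 * dsqV h) := by
  have hq := Real.two_pi_pos
  have hcc : ∀ {f : ℂ → Fin n → ℂ}, MemW12V f → ∀ t,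
      Continuous (fun θ => ‖f (ee (θ + t)) - f (ee θ)‖ ^ 2) := fun hf t =>
    ((((memV_cont hf).comp (continuous_add_const t)).sub (memV_cont hf)).norm.pow 2)
  have key := shift_lower hV (4 * (a ^ 2 + b ^ 2 * dsqV f + c ^ 2 * dsqV k + d ^ 2 * dsqV h)) (by
    intro t ht
    have cf := hcc hf t
    have ck := hcc hk t
    have ch := hcc hh t
    have h1 : ∫ θ in (0:ℝ)..(2 * Real.pi), ‖V (ee (θ + t)) - V (ee θ)‖ ^ 2
       ≤ ∫ θ in (0:ℝ)..(2 * Real.pi), (4 * a ^ 2 * t ^ 2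
        + (4 * b ^ 2) * ‖f (ee (θ + t)) - f (ee θ)‖ ^ 2
        + (4 * c ^ 2) * ‖k (ee (θ + t)) - k (ee θ)‖ ^ 2
        + (4 * d ^ 2) * ‖h (ee (θ + t)) - h (ee θ)‖ ^ 2) := by
      apply intervalIntegral.integral_mono_on hq.le
      · exact (((hV.comp (continuous_add_const t)).sub hV).norm.pow 2).intervalIntegrable _ _
      · apply Continuous.intervalIntegrable
        fun_prop
      · intro θ hθ
        have h2 := hdiff θ hθ t ht
        have h3 := four_sq (a * |t|) (b * ‖f (ee (θ + t)) - f (ee θ)‖)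
          (c * ‖k (ee (θ + t)) - k (ee θ)‖) (d * ‖h (ee (θ + t)) - h (ee θ)‖)
        have h4 := pow_le_pow_left₀ (norm_nonneg _) h2 2
        refine (h4.trans h3).trans (le_of_eq ?_)
        simp only [mul_pow, sq_abs]
        ring
    rw [intervalIntegral.integral_add, intervalIntegral.integral_add, intervalIntegral.integral_add,
      intervalIntegral.integral_const, intervalIntegral.integral_const_mul,
      intervalIntegral.integral_const_mul, intervalIntegral.integral_const_mul, smul_eq_mul, sub_zero] at h1
    rotate_left
    · apply Continuous.intervalIntegrable; fun_prop
    · apply Continuous.intervalIntegrable; fun_prop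
    · apply Continuous.intervalIntegrable; fun_prop
    · apply Continuous.intervalIntegrable; fun_prop
    · apply Continuous.intervalIntegrable; fun_prop
    · apply Continuous.intervalIntegrable; fun_prop
    have uf := shift_upperV hf t
    have uk := shift_upperV hk t
    have uh := shift_upperV hh t
    rw [inv_mul_le_iff₀ hq] at uf uk uh ⊢
    have := mul_le_mul_of_nonneg_left uf (by positivity : 0 ≤ 4 * b ^ 2)
    have := mul_le_mul_of_nonneg_left uk (by positivity : 0 ≤ 4 * c ^ 2)
    have := mul_le_mul_of_nonneg_left uh (by positivity : 0 ≤ 4 * d ^ 2)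
    linarith)
  refine ⟨key.1, (w12NormSq_le hV hC hm).trans ?_⟩
  linarith [key.2]

lemma w12VNorm_sq {Cc : ℝ} (hC : 0 < Cc) (f : ℂ → Fin n → ℂ) :
    w12VNorm Cc f ^ 2 = ∑ i, w12NormSq Cc (fun z => f z i) := by
  unfold w12VNorm
  apply Real.sq_sqrt
  refine Finset.sum_nonneg fun i _ => ?_
  unfold w12NormSq
  have h1 : 0 ≤ ∑' j : ℤ, ‖bCoeff (fun z => f z i) j‖^2 := tsum_nonneg fun j => by positivity
  have h2 : 0 ≤ ∑' j : ℤ, (j:ℝ)^2 * ‖bCoeff (fun z => f z i) j‖^2 := tsum_nonneg fun j => by positivity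
  positivity

lemma dsqV_le {Cc : ℝ} (hC : 0 < Cc) (f : ℂ → Fin n → ℂ) : dsqV f ≤ w12VNorm Cc f ^ 2 := by
  rw [w12VNorm_sq hC]
  refine Finset.sum_le_sum fun i _ => ?_
  unfold w12NormSq dsq
  have h1 : 0 ≤ ∑' j : ℤ, ‖bCoeff (fun z => f z i) j‖^2 := tsum_nonneg fun j => by positivity
  have := mul_nonneg hC.le h1
  linarith

lemma sobolevV (Cc : ℝ) (hC : 0 < Cc) : ∃ K : ℝ, 0 < K ∧ ∀ f : ℂ → Fin n → ℂ, MemW12V f →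
    ∀ θ, ‖f (ee θ)‖ ≤ K * w12VNorm Cc f := by
  obtain ⟨K, hK, h⟩ := sobolev Cc hC
  refine ⟨K, hK, fun f hf θ => ?_⟩
  have h0 : 0 ≤ w12VNorm Cc f := Real.sqrt_nonneg _
  refine abs_le_of_sq_le_sq' ?_ (by positivity) |>.2
  calc ‖f (ee θ)‖ ^ 2 ≤ ∑ i, ‖f (ee θ) i‖ ^ 2 := norm_sq_le_sum _
    _ ≤ ∑ i, K ^ 2 * w12NormSq Cc (fun z => f z i) := Finset.sum_le_sum fun i _ => h _ (hf i) θ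
    _ = _ := by rw [← Finset.mul_sum, ← w12VNorm_sq hC, mul_pow]

lemma memW12V_sub {f g : ℂ → Fin n → ℂ} (hf : MemW12V f) (hg : MemW12V g) :
    MemW12V (fun z j => f z j - g z j) := by
  intro j
  obtain ⟨a1, a2⟩ := memW12_iff.1 (hf j)
  obtain ⟨b1, b2⟩ := memW12_iff.1 (hg j)
  refine memW12_iff.2 ⟨a1.sub b1, ?_⟩
  refine Summable.of_nonneg_of_le (fun _ => by positivity) (fun i => ?_) ((a2.mul_left 2).add (b2.mul_left 2))
  rw [bCoeff_sub a1 b1]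
  have h1 := norm_sub_le (bCoeff (fun z => f z j) i) (bCoeff (fun z => g z j) i)
  have h2 := pow_le_pow_left₀ (norm_nonneg _) h1 2
  have h3 : (‖bCoeff (fun z => f z j) i‖ + ‖bCoeff (fun z => g z j) i‖) ^ 2
    ≤ 2 * ‖bCoeff (fun z => f z j) i‖ ^ 2 + 2 * ‖bCoeff (fun z => g z j) i‖ ^ 2 := by
    nlinarith [sq_nonneg (‖bCoeff (fun z => f z j) i‖ - ‖bCoeff (fun z => g z j) i‖)]
  calc _ ≤ (i:ℝ)^2 * (2 * ‖bCoeff (fun z => f z j) i‖ ^ 2 + 2 * ‖bCoeff (fun z => g z j) i‖ ^ 2) := by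
        gcongr; exact h2.trans h3
    _ = _ := by ring

end master

section final
variable {n : ℕ}

/-- `p` in the angular coordinate. -/
def GG (p : ℂ → (Fin n → ℂ) → ℝ) : ℝ × (Fin n → ℂ) → ℝ := fun x => p (ee x.1) x.2

lemma GG_contDiff {p : ℂ → (Fin n → ℂ) → ℝ}
    (hp : ContDiffOn ℝ 3 (fun q : ℂ × (Fin n → ℂ) => p q.1 q.2)
      {q : ℂ × (Fin n → ℂ) | q.1 ∈ Circ}) : ContDiff ℝ 3 (GG p) := by
  have h1 : ContDiff ℝ 3 (fun x : ℝ × (Fin n → ℂ) => ((ee x.1, x.2) : ℂ × (Fin n → ℂ))) := by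
    refine ContDiff.prodMk ?_ contDiff_snd
    unfold ee
    refine ContDiff.cexp (ContDiff.mul ?_ contDiff_const)
    exact Complex.ofRealCLM.contDiff.comp contDiff_fst
  exact hp.comp_contDiff h1 (fun x => ee_mem x.1)

lemma GG_fderiv {p : ℂ → (Fin n → ℂ) → ℝ} (hG : ContDiff ℝ 3 (GG p)) (θ : ℝ) (w v : Fin n → ℂ) :
    fderiv ℝ (p (ee θ)) w v = fderiv ℝ (GG p) (θ, w) (0, v) := by
  have h1 : HasFDerivAt (GG p) (fderiv ℝ (GG p) (θ, w)) (θ, w) :=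
    (hG.differentiable three_ne_zero _).hasFDerivAt
  have h2 : HasFDerivAt (fun w : Fin n → ℂ => (θ, w)) (ContinuousLinearMap.inr ℝ ℝ (Fin n → ℂ)) w :=
    hasFDerivAt_prodMk_right θ w
  have h3 := h1.comp w h2
  have h4 : GG p ∘ (fun w : Fin n → ℂ => (θ, w)) = p (ee θ) := rfl
  rw [h4] at h3
  rw [h3.fderiv]
  simp

lemma norm_pair_le (t : ℝ) (w : Fin n → ℂ) : ‖((t, w) : ℝ × (Fin n → ℂ))‖ ≤ |t| + ‖w‖ := by
  rw [Prod.norm_def]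
  exact max_le (by simp) (by simp)

lemma norm_zpair (w : Fin n → ℂ) : ‖((0, w) : ℝ × (Fin n → ℂ))‖ = ‖w‖ := by
  simp [Prod.norm_def]

lemma range1 {θ : ℝ} (hθ : θ ∈ Icc (0:ℝ) (2 * Real.pi)) {t : ℝ} (ht : |t| ≤ 1) : |θ + t| ≤ 8 := by
  have := Real.pi_lt_d2
  rw [abs_le] at ht ⊢
  constructor <;> linarith [hθ.1, hθ.2, ht.1, ht.2]

lemma mem_ball_x {f : ℂ → Fin n → ℂ} {B R : ℝ} (hB : ∀ θ, ‖f (ee θ)‖ ≤ B) (hR : 8 + B ≤ R)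
    {θ : ℝ} (hθ : |θ| ≤ 8) : ((θ, f (ee θ)) : ℝ × (Fin n → ℂ)) ∈ closedBall 0 R := by
  rw [mem_closedBall, dist_zero_right]
  exact (norm_pair_le _ _).trans (by linarith [hB θ])

lemma diff_x (f : ℂ → Fin n → ℂ) (θ t : ℝ) :
    ‖((θ + t, f (ee (θ + t))) : ℝ × (Fin n → ℂ)) - (θ, f (ee θ))‖
      ≤ |t| + ‖f (ee (θ + t)) - f (ee θ)‖ := by
  rw [Prod.mk_sub_mk, add_sub_cancel_left]
  exact norm_pair_le _ _

lemma x_cont {f : ℂ → Fin n → ℂ} (hf : MemW12V f) :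
    Continuous (fun θ : ℝ => ((θ, f (ee θ)) : ℝ × (Fin n → ℂ))) :=
  continuous_id.prodMk (memV_cont hf)

lemma w12Norm_le {Cc : ℝ} {V : ℂ → ℂ} {C0 N : ℝ} (hN : 0 ≤ N) (hC0 : 0 ≤ C0)
    (h : w12NormSq Cc V ≤ C0 * N ^ 2) : w12Norm Cc V ≤ Real.sqrt C0 * N := by
  unfold w12Norm
  refine (Real.sqrt_le_sqrt h).trans ?_
  rw [Real.sqrt_mul hC0, Real.sqrt_sq hN]

lemma part1 {Cc : ℝ} (hCc : 0 < Cc) {p : ℂ → (Fin n → ℂ) → ℝ} (hG : ContDiff ℝ 3 (GG p))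
    {f : ℂ → Fin n → ℂ} (hf : MemW12V f) : MemW12 (fun z => ((p z (f z) : ℝ) : ℂ)) := by
  obtain ⟨K, hK, hS⟩ := sobolevV (n := n) Cc hCc
  set R := 8 + K * w12VNorm Cc f with hR
  obtain ⟨L, hL, hl⟩ := lip_ball (hG.of_le (by norm_num : (1 : WithTop ℕ∞) ≤ 3)) R
  obtain ⟨M, hM⟩ := (isCompact_closedBall (0 : ℝ × (Fin n → ℂ)) R).exists_bound_of_continuousOn
    hG.continuous.continuousOn
  have hc : Continuous (fun θ : ℝ => ((GG p (θ, f (ee θ)) : ℝ) : ℂ)) :=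
    Complex.continuous_ofReal.comp (hG.continuous.comp (x_cont hf))
  refine (master hf hf hf (V := fun z => ((p z (f z) : ℝ) : ℂ)) hc hCc M L L 0 0 ?_ ?_).1
  · intro θ hθ
    have h0 := range1 hθ (t := 0) (by simp)
    rw [add_zero] at h0
    simpa [GG] using hM _ (mem_ball_x (hS f hf) le_rfl h0)
  · intro θ hθ t ht
    have h0 := range1 hθ (t := 0) (by simp)
    rw [add_zero] at h0
    have h1 := range1 hθ ht
    have h2 := hl _ (mem_ball_x (hS f hf) hR.ge h0) _ (mem_ball_x (hS f hf) hR.ge h1)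
    have h3 := mul_le_mul_of_nonneg_left (diff_x f θ t) hL
    simp only [GG, Real.norm_eq_abs] at h2
    rw [← Complex.ofReal_sub, Complex.norm_real, Real.norm_eq_abs]
    linarith

lemma part2 {Cc : ℝ} (hCc : 0 < Cc) {p : ℂ → (Fin n → ℂ) → ℝ} (hG : ContDiff ℝ 3 (GG p))
    {f : ℂ → Fin n → ℂ} (hf : MemW12V f) : ∃ Cb : ℝ, ∀ h : ℂ → Fin n → ℂ, MemW12V h →
      MemW12 (fun z => (((fderiv ℝ (p z) (f z)) (h z) : ℝ) : ℂ)) ∧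
      w12Norm Cc (fun z => (((fderiv ℝ (p z) (f z)) (h z) : ℝ) : ℂ)) ≤ Cb * w12VNorm Cc h := by
  obtain ⟨K, hK, hS⟩ := sobolevV (n := n) Cc hCc
  set R := 8 + K * w12VNorm Cc f with hR
  have hD : ContDiff ℝ 2 (fderiv ℝ (GG p)) := hG.fderiv_right (m := 2) (by norm_num)
  obtain ⟨L, hL, hl⟩ := lip_ball (hD.of_le one_le_two) R
  obtain ⟨M, hM⟩ := (isCompact_closedBall (0 : ℝ × (Fin n → ℂ)) R).exists_bound_of_continuousOn
    hD.continuous.continuousOn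
  have hM0 : 0 ≤ M := by
    have h0 : 0 ≤ R := by
      have : 0 ≤ w12VNorm Cc f := Real.sqrt_nonneg _
      positivity
    exact (norm_nonneg _).trans (hM 0 (by simpa using h0))
  set C0 := Cc * (M * K) ^ 2 + 4 * ((L * K) ^ 2 + (L * K) ^ 2 * dsqV f + M ^ 2) with hC0
  have hC0n : 0 ≤ C0 := by
    have := dsqV_nonneg f
    positivity
  refine ⟨Real.sqrt C0, fun h hh => ?_⟩
  have hN : 0 ≤ w12VNorm Cc h := Real.sqrt_nonneg _
  set N := w12VNorm Cc h with hNdef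
  have hcc : Continuous (fun θ : ℝ => fderiv ℝ (GG p) (θ, f (ee θ)) (0, h (ee θ))) :=
    (hD.continuous.comp (x_cont hf)).clm_apply (continuous_const.prodMk (memV_cont hh))
  have hc : Continuous (fun θ : ℝ => (((fderiv ℝ (p (ee θ)) (f (ee θ))) (h (ee θ)) : ℝ) : ℂ)) := by
    simp_rw [GG_fderiv hG]
    exact Complex.continuous_ofReal.comp hcc
  have key := master hf hf hh (V := fun z => (((fderiv ℝ (p z) (f z)) (h z) : ℝ) : ℂ)) hc hCc
    (M * (K * N)) (L * (K * N)) (L * (K * N)) 0 M ?_ ?_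
  · refine ⟨key.1, w12Norm_le hN hC0n (key.2.trans ?_)⟩
    have h1 := mul_le_mul_of_nonneg_left (dsqV_le hCc h) (sq_nonneg M)
    rw [hC0]
    have e : Cc * (M * (K * N)) ^ 2 + 4 * ((L * (K * N)) ^ 2 + (L * (K * N)) ^ 2 * dsqV f
      + 0 ^ 2 * dsqV f + M ^ 2 * N ^ 2) =
      (Cc * (M * K) ^ 2 + 4 * ((L * K) ^ 2 + (L * K) ^ 2 * dsqV f + M ^ 2)) * N ^ 2 := by ring
    linarith
  · intro θ hθ
    have h0 := range1 hθ (t := 0) (by simp)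
    rw [add_zero] at h0
    have h1 := hM _ (mem_ball_x (hS f hf) hR.ge h0)
    simp only [GG_fderiv hG, Complex.norm_real]
    refine (ContinuousLinearMap.le_opNorm _ _).trans ?_
    rw [norm_zpair]
    exact mul_le_mul h1 (hS h hh θ) (norm_nonneg _) hM0
  · intro θ hθ t ht
    have h0 := range1 hθ (t := 0) (by simp)
    rw [add_zero] at h0
    have h1 := range1 hθ ht
    have x0 := mem_ball_x (hS f hf) hR.ge h0
    have x1 := mem_ball_x (hS f hf) hR.ge h1
    have h2 := (hl _ x0 _ x1).trans (mul_le_mul_of_nonneg_left (diff_x f θ t) hL)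
    have h4 := hM _ x0
    have h5 := hS h hh (θ + t)
    simp only [GG_fderiv hG]
    rw [← Complex.ofReal_sub, Complex.norm_real]
    have e : fderiv ℝ (GG p) (θ + t, f (ee (θ + t))) (0, h (ee (θ + t)))
        - fderiv ℝ (GG p) (θ, f (ee θ)) (0, h (ee θ))
      = (fderiv ℝ (GG p) (θ + t, f (ee (θ + t))) - fderiv ℝ (GG p) (θ, f (ee θ))) (0, h (ee (θ + t)))
        + fderiv ℝ (GG p) (θ, f (ee θ)) (0, h (ee (θ + t)) - h (ee θ)) := by
      have : ((0, h (ee (θ + t)) - h (ee θ)) : ℝ × (Fin n → ℂ))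
        = (0, h (ee (θ + t))) - (0, h (ee θ)) := by simp
      rw [this, map_sub, ContinuousLinearMap.sub_apply]; ring
    rw [e]
    refine (norm_add_le _ _).trans ?_
    have e1 : ‖(fderiv ℝ (GG p) (θ + t, f (ee (θ + t))) - fderiv ℝ (GG p) (θ, f (ee θ))) (0, h (ee (θ + t)))‖
        ≤ (L * (|t| + ‖f (ee (θ + t)) - f (ee θ)‖)) * (K * N) := by
      refine (ContinuousLinearMap.le_opNorm _ _).trans ?_
      rw [norm_zpair]
      exact mul_le_mul h2 h5 (norm_nonneg _) (by positivity)
    have e2 : ‖fderiv ℝ (GG p) (θ, f (ee θ)) (0, h (ee (θ + t)) - h (ee θ))‖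
        ≤ M * ‖h (ee (θ + t)) - h (ee θ)‖ := by
      refine (ContinuousLinearMap.le_opNorm _ _).trans ?_
      rw [norm_zpair]
      exact mul_le_mul_of_nonneg_right h4 (norm_nonneg _)
    linarith

lemma part3 {Cc : ℝ} (hCc : 0 < Cc) {p : ℂ → (Fin n → ℂ) → ℝ} (hG : ContDiff ℝ 3 (GG p))
    {f : ℂ → Fin n → ℂ} (hf : MemW12V f) : ∃ Cb : ℝ, 0 ≤ Cb ∧ ∀ h : ℂ → Fin n → ℂ, MemW12V h →
      w12VNorm Cc h ≤ 1 →
      w12Norm Cc (fun z =>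
          ((p z (fun j => f z j + h z j) : ℝ) : ℂ) - ((p z (f z) : ℝ) : ℂ)
            - (((fderiv ℝ (p z) (f z)) (h z) : ℝ) : ℂ)) ≤ Cb * w12VNorm Cc h ^ 2 := by
  obtain ⟨K, hK, hS⟩ := sobolevV (n := n) Cc hCc
  have hBf : 0 ≤ w12VNorm Cc f := Real.sqrt_nonneg _
  set R := 8 + K * w12VNorm Cc f + K with hR
  have hR1 : 8 + K * w12VNorm Cc f ≤ R := by linarith
  have hR2 : K ≤ R := by
    have : 0 ≤ K * w12VNorm Cc f := by positivity
    linarith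
  obtain ⟨L, hL, hl⟩ := third_ball hG R
  have hD : ContDiff ℝ 2 (fderiv ℝ (GG p)) := hG.fderiv_right (m := 2) (by norm_num)
  set C0 := Cc * (L * K ^ 2) ^ 2 + 4 * ((L * K ^ 2) ^ 2 + (L * K ^ 2) ^ 2 * dsqV f + (L * K) ^ 2) with hC0
  have hC0n : 0 ≤ C0 := by
    have := dsqV_nonneg f
    positivity
  refine ⟨Real.sqrt C0, Real.sqrt_nonneg _, fun h hh hN1 => ?_⟩
  have hN : 0 ≤ w12VNorm Cc h := Real.sqrt_nonneg _
  set N := w12VNorm Cc h with hNdef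
  have hκ : K * N ≤ R := (mul_le_of_le_one_right hK.le hN1).trans hR2
  have hV : ∀ θ : ℝ, ((p (ee θ) (fun j => f (ee θ) j + h (ee θ) j) : ℝ) : ℂ) - ((p (ee θ) (f (ee θ)) : ℝ) : ℂ)
            - (((fderiv ℝ (p (ee θ)) (f (ee θ))) (h (ee θ)) : ℝ) : ℂ)
      = ((GG p ((θ, f (ee θ)) + (0, h (ee θ))) - GG p (θ, f (ee θ))
        - fderiv ℝ (GG p) (θ, f (ee θ)) (0, h (ee θ)) : ℝ) : ℂ) := by
    intro θ
    rw [GG_fderiv hG]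
    push_cast
    simp only [GG, Prod.mk_add_mk, add_zero]
    rfl
  have hcc : Continuous (fun θ : ℝ => fderiv ℝ (GG p) (θ, f (ee θ)) (0, h (ee θ))) :=
    (hD.continuous.comp (x_cont hf)).clm_apply (continuous_const.prodMk (memV_cont hh))
  have hc : Continuous (fun θ : ℝ => ((GG p ((θ, f (ee θ)) + (0, h (ee θ))) - GG p (θ, f (ee θ))
        - fderiv ℝ (GG p) (θ, f (ee θ)) (0, h (ee θ)) : ℝ) : ℂ)) :=
    Complex.continuous_ofReal.comp (((hG.continuous.comp ((x_cont hf).add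
      (continuous_const.prodMk (memV_cont hh)))).sub (hG.continuous.comp (x_cont hf))).sub hcc)
  have kmem : ∀ θ, ((0, h (ee θ)) : ℝ × (Fin n → ℂ)) ∈ closedBall 0 (K * N) := by
    intro θ
    rw [mem_closedBall, dist_zero_right, norm_zpair]
    exact hS h hh θ
  have key := master hf hf hh (V := fun z =>
          ((p z (fun j => f z j + h z j) : ℝ) : ℂ) - ((p z (f z) : ℝ) : ℂ)
            - (((fderiv ℝ (p z) (f z)) (h z) : ℝ) : ℂ)) (by simp_rw [hV]; exact hc) hCc
    (L * (K * N) ^ 2) (L * (K * N) ^ 2) (L * (K * N) ^ 2) 0 (L * (K * N)) ?_ ?_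
  · refine w12Norm_le (sq_nonneg N) hC0n (key.2.trans ?_)
    have h1 := mul_le_mul_of_nonneg_left (dsqV_le hCc h) (sq_nonneg (L * (K * N)))
    rw [hC0]
    have e : Cc * (L * (K * N) ^ 2) ^ 2 + 4 * ((L * (K * N) ^ 2) ^ 2 + (L * (K * N) ^ 2) ^ 2 * dsqV f
      + 0 ^ 2 * dsqV f + (L * (K * N)) ^ 2 * N ^ 2) =
      (Cc * (L * K ^ 2) ^ 2 + 4 * ((L * K ^ 2) ^ 2 + (L * K ^ 2) ^ 2 * dsqV f + (L * K) ^ 2)) * (N ^ 2) ^ 2 := by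
      ring
    linarith
  · intro θ hθ
    have h0 := range1 hθ (t := 0) (by simp)
    rw [add_zero] at h0
    have x0 := mem_ball_x (hS f hf) hR1 h0
    have := (hl _ hκ _ x0 _ x0 _ (kmem θ) _ (kmem θ)).2
    simp only [hV, Complex.norm_real, Real.norm_eq_abs]
    exact this
  · intro θ hθ t ht
    have h0 := range1 hθ (t := 0) (by simp)
    rw [add_zero] at h0
    have h1 := range1 hθ ht
    have x0 := mem_ball_x (hS f hf) hR1 h0
    have x1 := mem_ball_x (hS f hf) hR1 h1
    have h2 := (hl _ hκ _ x0 _ x1 _ (kmem θ) _ (kmem (θ + t))).1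
    have h3 := mul_le_mul_of_nonneg_left (diff_x f θ t) (by positivity : 0 ≤ L * (K * N) ^ 2)
    simp only [hV]
    rw [← Complex.ofReal_sub, Complex.norm_real, Real.norm_eq_abs]
    refine h2.trans ?_
    have : ‖((0, h (ee (θ + t))) : ℝ × (Fin n → ℂ)) - (0, h (ee θ))‖ = ‖h (ee (θ + t)) - h (ee θ)‖ := by
      rw [Prod.mk_sub_mk, sub_zero, norm_zpair]
    rw [this]
    linarith

lemma part4 {Cc : ℝ} (hCc : 0 < Cc) {p : ℂ → (Fin n → ℂ) → ℝ} (hG : ContDiff ℝ 3 (GG p))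
    {f : ℂ → Fin n → ℂ} (hf : MemW12V f) : ∃ Cb : ℝ, 0 ≤ Cb ∧ ∀ f' : ℂ → Fin n → ℂ, MemW12V f' →
      w12VNorm Cc (fun z => fun j => f' z j - f z j) ≤ 1 →
      ∀ h : ℂ → Fin n → ℂ, MemW12V h →
          w12Norm Cc (fun z =>
            (((fderiv ℝ (p z) (f' z)) (h z) : ℝ) : ℂ)
              - (((fderiv ℝ (p z) (f z)) (h z) : ℝ) : ℂ))
            ≤ Cb * (w12VNorm Cc (fun z => fun j => f' z j - f z j) * w12VNorm Cc h) := by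
  obtain ⟨K, hK, hS⟩ := sobolevV (n := n) Cc hCc
  have hBf : 0 ≤ w12VNorm Cc f := Real.sqrt_nonneg _
  set R := 8 + K * w12VNorm Cc f + K with hR
  have hR1 : 8 + K * w12VNorm Cc f ≤ R := by linarith
  have hR2 : K ≤ R := by
    have : 0 ≤ K * w12VNorm Cc f := by positivity
    linarith
  have hD : ContDiff ℝ 2 (fderiv ℝ (GG p)) := hG.fderiv_right (m := 2) (by norm_num)
  obtain ⟨L, hL, hl⟩ := second_ball hD R
  set C0 := Cc * (L * K ^ 2) ^ 2 + 4 * ((L * K ^ 2) ^ 2 + (L * K ^ 2) ^ 2 * dsqV f + 2 * (L * K) ^ 2) with hC0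
  have hC0n : 0 ≤ C0 := by
    have := dsqV_nonneg f
    positivity
  refine ⟨Real.sqrt C0, Real.sqrt_nonneg _, fun f' hf' hN1 h hh => ?_⟩
  have hk := memW12V_sub hf' hf
  obtain ⟨k, hkd⟩ : ∃ k : ℂ → Fin n → ℂ, k = fun z j => f' z j - f z j := ⟨_, rfl⟩
  rw [← hkd] at hk hN1 ⊢
  have hf'k : ∀ z, f' z = f z + k z := by
    intro z; ext j; simp [hkd]
  have hN : 0 ≤ w12VNorm Cc h := Real.sqrt_nonneg _
  have hNk : 0 ≤ w12VNorm Cc k := Real.sqrt_nonneg _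
  set N := w12VNorm Cc h with hNdef
  set Nk := w12VNorm Cc k with hNkdef
  have hκ : K * Nk ≤ R := (mul_le_of_le_one_right hK.le hN1).trans hR2
  -- the operator difference
  obtain ⟨Q, hQ⟩ : ∃ Q : ℝ → (ℝ × (Fin n → ℂ)) →L[ℝ] ℝ, Q = fun θ =>
    fderiv ℝ (GG p) ((θ, f (ee θ)) + (0, k (ee θ))) - fderiv ℝ (GG p) (θ, f (ee θ)) := ⟨_, rfl⟩
  have hQc : Continuous Q := by
    rw [hQ]
    exact (hD.continuous.comp ((x_cont hf).add (continuous_const.prodMk (memV_cont hk)))).sub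
      (hD.continuous.comp (x_cont hf))
  have hV : ∀ θ : ℝ, (((fderiv ℝ (p (ee θ)) (f' (ee θ))) (h (ee θ)) : ℝ) : ℂ)
              - (((fderiv ℝ (p (ee θ)) (f (ee θ))) (h (ee θ)) : ℝ) : ℂ)
      = ((Q θ (0, h (ee θ)) : ℝ) : ℂ) := by
    intro θ
    rw [GG_fderiv hG, GG_fderiv hG, hQ, hf'k]
    simp
  have hc : Continuous (fun θ : ℝ => ((Q θ (0, h (ee θ)) : ℝ) : ℂ)) :=
    Complex.continuous_ofReal.comp (hQc.clm_apply (continuous_const.prodMk (memV_cont hh)))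
  have kmem : ∀ θ, ((0, k (ee θ)) : ℝ × (Fin n → ℂ)) ∈ closedBall 0 R := by
    intro θ
    rw [mem_closedBall, dist_zero_right, norm_zpair]
    exact (hS k hk θ).trans hκ
  have hQb : ∀ θ, |θ| ≤ 8 → ‖Q θ‖ ≤ L * (K * Nk) := by
    intro θ hθ
    have x0 := mem_ball_x (hS f hf) hR1 hθ
    have := hl _ x0 _ x0 0 (by simpa using hK.le.trans hR2) _ (kmem θ)
    simp only [add_zero, sub_self, sub_zero, norm_zero, mul_zero, zero_add, norm_zpair] at this
    rw [hQ]
    exact this.trans (mul_le_mul_of_nonneg_left (hS k hk θ) hL)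
  have key := master hf hk hh (V := fun z =>
          (((fderiv ℝ (p z) (f' z)) (h z) : ℝ) : ℂ)
              - (((fderiv ℝ (p z) (f z)) (h z) : ℝ) : ℂ)) (by simp_rw [hV]; exact hc) hCc
    (L * (K * Nk) * (K * N)) (L * (K * Nk) * (K * N)) (L * (K * Nk) * (K * N)) (L * (K * N)) (L * (K * Nk)) ?_ ?_
  · refine w12Norm_le (mul_nonneg hNk hN) hC0n (key.2.trans ?_)
    have h1 := mul_le_mul_of_nonneg_left (dsqV_le hCc h) (sq_nonneg (L * (K * Nk)))
    have h2 := mul_le_mul_of_nonneg_left (dsqV_le hCc k) (sq_nonneg (L * (K * N)))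
    rw [hC0]
    have e : Cc * (L * (K * Nk) * (K * N)) ^ 2 + 4 * ((L * (K * Nk) * (K * N)) ^ 2
        + (L * (K * Nk) * (K * N)) ^ 2 * dsqV f
        + (L * (K * N)) ^ 2 * Nk ^ 2 + (L * (K * Nk)) ^ 2 * N ^ 2) =
      (Cc * (L * K ^ 2) ^ 2 + 4 * ((L * K ^ 2) ^ 2 + (L * K ^ 2) ^ 2 * dsqV f + 2 * (L * K) ^ 2))
        * (Nk * N) ^ 2 := by
      ring
    linarith
  · intro θ hθ
    have h0 := range1 hθ (t := 0) (by simp)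
    rw [add_zero] at h0
    simp only [hV, Complex.norm_real]
    refine (ContinuousLinearMap.le_opNorm _ _).trans ?_
    rw [norm_zpair]
    exact mul_le_mul (hQb θ h0) (hS h hh θ) (norm_nonneg _) (by positivity)
  · intro θ hθ t ht
    have h0 := range1 hθ (t := 0) (by simp)
    rw [add_zero] at h0
    have h1 := range1 hθ ht
    have x0 := mem_ball_x (hS f hf) hR1 h0
    have x1 := mem_ball_x (hS f hf) hR1 h1
    have h2 := hl _ x0 _ x1 _ (kmem θ) _ (kmem (θ + t))
    have hk2 : ‖((0, k (ee (θ + t))) : ℝ × (Fin n → ℂ)) - (0, k (ee θ))‖ = ‖k (ee (θ + t)) - k (ee θ)‖ := by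
      rw [Prod.mk_sub_mk, sub_zero, norm_zpair]
    rw [hk2, norm_zpair] at h2
    have hQd : ‖Q (θ + t) - Q θ‖ ≤ L * ((K * Nk) * (|t| + ‖f (ee (θ + t)) - f (ee θ)‖)
        + ‖k (ee (θ + t)) - k (ee θ)‖) := by
      rw [hQ]
      refine h2.trans (mul_le_mul_of_nonneg_left ?_ hL)
      gcongr
      · exact hS k hk θ
      · exact diff_x f θ t
    simp only [hV]
    rw [← Complex.ofReal_sub, Complex.norm_real]
    have e : Q (θ + t) (0, h (ee (θ + t))) - Q θ (0, h (ee θ))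
      = (Q (θ + t) - Q θ) (0, h (ee (θ + t))) + Q θ (0, h (ee (θ + t)) - h (ee θ)) := by
      have : ((0, h (ee (θ + t)) - h (ee θ)) : ℝ × (Fin n → ℂ))
        = (0, h (ee (θ + t))) - (0, h (ee θ)) := by simp
      rw [this, map_sub, ContinuousLinearMap.sub_apply]; ring
    rw [e]
    refine (norm_add_le _ _).trans ?_
    have e1 : ‖(Q (θ + t) - Q θ) (0, h (ee (θ + t)))‖
        ≤ (L * ((K * Nk) * (|t| + ‖f (ee (θ + t)) - f (ee θ)‖)
        + ‖k (ee (θ + t)) - k (ee θ)‖)) * (K * N) := by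
      refine (ContinuousLinearMap.le_opNorm _ _).trans ?_
      rw [norm_zpair]
      exact mul_le_mul hQd (hS h hh _) (norm_nonneg _) (by positivity)
    have e2 : ‖Q θ (0, h (ee (θ + t)) - h (ee θ))‖
        ≤ L * (K * Nk) * ‖h (ee (θ + t)) - h (ee θ)‖ := by
      refine (ContinuousLinearMap.le_opNorm _ _).trans ?_
      rw [norm_zpair]
      exact mul_le_mul_of_nonneg_right (hQb θ h0) (norm_nonneg _)
    linarith

end final


/-- the Appendix Lemma: the composition operator
`P(f)(z) = p(z,f(z))` is a well-defined `C¹` map `(W^{1,2}(Γ))ⁿ → W^{1,2}(Γ)`,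
with derivative `DP(f)[h](z) = Dp(z,f(z))[0,h(z)]`. -/
theorem statement13 {n : ℕ} (hn : 2 ≤ n) (Cc : ℝ) (hCc : 0 < Cc)
    (p : ℂ → (Fin n → ℂ) → ℝ)
    (hp : ContDiffOn ℝ 3 (fun q : ℂ × (Fin n → ℂ) => p q.1 q.2)
      {q : ℂ × (Fin n → ℂ) | q.1 ∈ Circ}) :
    -- well-definedness
    (∀ f : ℂ → Fin n → ℂ, MemW12V f → MemW12 (fun z => ((p z (f z) : ℝ) : ℂ))) ∧
    -- the derivative maps W^{1,2} to W^{1,2} boundedly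
    (∀ f : ℂ → Fin n → ℂ, MemW12V f →
      (∀ h : ℂ → Fin n → ℂ, MemW12V h →
        MemW12 (fun z => (((fderiv ℝ (p z) (f z)) (h z) : ℝ) : ℂ))) ∧
      ∃ Cb : ℝ, ∀ h : ℂ → Fin n → ℂ, MemW12V h →
        w12Norm Cc (fun z => (((fderiv ℝ (p z) (f z)) (h z) : ℝ) : ℂ)) ≤ Cb * w12VNorm Cc h) ∧
    -- Fréchet differentiability with derivative T_f[h](z) = Dp(z,f(z))[0,h(z)]
    (∀ f : ℂ → Fin n → ℂ, MemW12V f → ∀ ε : ℝ, 0 < ε → ∃ δ : ℝ, 0 < δ ∧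
      ∀ h : ℂ → Fin n → ℂ, MemW12V h → w12VNorm Cc h ≤ δ →
        w12Norm Cc (fun z =>
          ((p z (fun j => f z j + h z j) : ℝ) : ℂ) - ((p z (f z) : ℝ) : ℂ)
            - (((fderiv ℝ (p z) (f z)) (h z) : ℝ) : ℂ))
          ≤ ε * w12VNorm Cc h) ∧
    -- continuity of the derivative in f (in operator norm)
    (∀ f : ℂ → Fin n → ℂ, MemW12V f → ∀ ε : ℝ, 0 < ε → ∃ δ : ℝ, 0 < δ ∧
      ∀ f' : ℂ → Fin n → ℂ, MemW12V f' →
        w12VNorm Cc (fun z => fun j => f' z j - f z j) ≤ δ →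
        ∀ h : ℂ → Fin n → ℂ, MemW12V h →
          w12Norm Cc (fun z =>
            (((fderiv ℝ (p z) (f' z)) (h z) : ℝ) : ℂ)
              - (((fderiv ℝ (p z) (f z)) (h z) : ℝ) : ℂ))
            ≤ ε * w12VNorm Cc h) := by
  have hG := GG_contDiff hp
  have hdel : ∀ Cb ε N : ℝ, 0 ≤ Cb → 0 < ε → 0 ≤ N → N ≤ min 1 (ε / (Cb + 1)) → Cb * N ≤ ε := by
    intro Cb ε N hCb hε hN h
    have h1 := (le_div_iff₀ (by positivity)).1 (h.trans (min_le_right _ _))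
    nlinarith
  refine ⟨fun f hf => part1 hCc hG hf, fun f hf => ?_, fun f hf ε hε => ?_, fun f hf ε hε => ?_⟩
  · obtain ⟨Cb, h⟩ := part2 hCc hG hf
    exact ⟨fun g hg => (h g hg).1, Cb, fun g hg => (h g hg).2⟩
  · obtain ⟨Cb, hCb, h⟩ := part3 hCc hG hf
    refine ⟨min 1 (ε / (Cb + 1)), by positivity, fun g hg hN => ?_⟩
    have hN0 : 0 ≤ w12VNorm Cc g := Real.sqrt_nonneg _
    refine (h g hg (hN.trans (min_le_left _ _))).trans ?_
    rw [pow_two, ← mul_assoc]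
    exact mul_le_mul_of_nonneg_right (hdel _ _ _ hCb hε hN0 hN) hN0
  · obtain ⟨Cb, hCb, h⟩ := part4 hCc hG hf
    refine ⟨min 1 (ε / (Cb + 1)), by positivity, fun f' hf' hN g hg => ?_⟩
    have hN0 : 0 ≤ w12VNorm Cc g := Real.sqrt_nonneg _
    refine (h f' hf' (hN.trans (min_le_left _ _)) g hg).trans ?_
    rw [← mul_assoc]
    exact mul_le_mul_of_nonneg_right (hdel _ _ _ hCb hε (Real.sqrt_nonneg _) hN) hN0
end
end

section
/- Let ρ satisfy condition (3), 0 < t < R, z ∈ Γ, and let D^t_z be the closed domain enclosed by the level set {w ∈ ℂⁿ : ρ(z,w) = t}. Then D^t_z is polynomially convex and equals the polynomial hull of K^t_z = {w : ρ(z,w) = t}; moreover D^t_z is strictly hypoconvex, and the intersection of any 1-dimensional complex affine subspace of ℂⁿ with D^t_z is either a single point or the closure of a Jordan domain whose boundary is as smooth as ρ. -/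
open Complex Metric MeasureTheory Filter Set

noncomputable section

theorem flow_exists_aux {E : Type*} [NormedAddCommGroup E] [NormedSpace ℝ E] [CompleteSpace E]
    (X : E → E) {K : NNReal} (hK : LipschitzWith K X) {L : NNReal} (hL : ∀ x, ‖X x‖ ≤ L)
    (x₀ : E) (N r : NNReal) :
    ∃ α : E → ℝ → E, (∀ x ∈ closedBall x₀ r, α x 0 = x ∧
      ∀ t ∈ Icc (-(N:ℝ)) N, HasDerivWithinAt (α x) (X (α x t)) (Icc (-(N:ℝ)) N) t) ∧
      ∃ L' : NNReal, ∀ t ∈ Icc (-(N:ℝ)) N, LipschitzOnWith L' (α · t) (closedBall x₀ r) := by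
  have h0 : (0:ℝ) ∈ Icc (-(N:ℝ)) N := ⟨by simp, by simp⟩
  have := IsPicardLindelof.of_time_independent (f := X) (t₀ := ⟨0, h0⟩) (x₀ := x₀)
    (a := L * N + r) (r := r) (L := L) (K := K) (fun x _ => hL x) hK.lipschitzOnWith (by
      simp)
  exact this.exists_forall_mem_closedBall_eq_hasDerivWithinAt_lipschitzOnWith

theorem flow_uniq {E : Type*} [NormedAddCommGroup E] [NormedSpace ℝ E]
    (X : E → E) {K : NNReal} (hK : LipschitzWith K X) {f g : ℝ → E} {N M : ℝ} (hN : 0 < N)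
    (hNM : N ≤ M)
    (hf : ∀ t ∈ Icc (-N) N, HasDerivWithinAt f (X (f t)) (Icc (-N) N) t)
    (hg : ∀ t ∈ Icc (-M) M, HasDerivWithinAt g (X (g t)) (Icc (-M) M) t)
    (h0 : f 0 = g 0) : EqOn f g (Icc (-N) N) := by
  have hg' : ∀ t ∈ Icc (-N) N, HasDerivWithinAt g (X (g t)) (Icc (-N) N) t := fun t ht =>
    (hg t ⟨by linarith [ht.1], by linarith [ht.2]⟩).mono (Icc_subset_Icc (by linarith) hNM)
  refine ODE_solution_unique_of_mem_Icc (v := fun _ => X) (s := fun _ => univ) (K := K) (t₀ := 0)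
    (fun t _ => hK.lipschitzOnWith) ⟨by linarith, hN⟩
    (HasDerivWithinAt.continuousOn hf) (fun t ht => ?_) (fun _ _ => trivial)
    (HasDerivWithinAt.continuousOn hg') (fun t ht => ?_) (fun _ _ => trivial) h0
  · exact (hf t ⟨ht.1.le, ht.2.le⟩).hasDerivAt (Icc_mem_nhds ht.1 ht.2)
  · exact (hg' t ⟨ht.1.le, ht.2.le⟩).hasDerivAt (Icc_mem_nhds ht.1 ht.2)

theorem flow_exists {E : Type*} [NormedAddCommGroup E] [NormedSpace ℝ E] [CompleteSpace E]
    (X : E → E) {K : NNReal} (hK : LipschitzWith K X) {L : NNReal} (hL : ∀ x, ‖X x‖ ≤ L) :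
    ∃ Φ : E → ℝ → E, (∀ x, Φ x 0 = x) ∧ (∀ x t, HasDerivAt (Φ x) (X (Φ x t)) t) ∧
      (∀ t, Continuous (Φ · t)) ∧ (∀ x s t, Φ (Φ x s) t = Φ x (s + t)) ∧
      (∀ x, X x = 0 → ∀ t, Φ x t = x) := by
  have key : ∀ x : E, ∃ γ : ℝ → E, γ 0 = x ∧ ∀ t, HasDerivAt γ (X (γ t)) t := by
    intro x
    have h1 : ∀ N : NNReal, ∃ α : ℝ → E, α 0 = x ∧
      ∀ t ∈ Icc (-(N:ℝ)) N, HasDerivWithinAt α (X (α t)) (Icc (-(N:ℝ)) N) t := by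
      intro N
      obtain ⟨α, h, -⟩ := flow_exists_aux X hK hL x N 0
      exact ⟨α x, h x (by simp)⟩
    choose α hα0 hα using h1
    have hcomp : ∀ N M : NNReal, 0 < N → N ≤ M → EqOn (α N) (α M) (Icc (-(N:ℝ)) N) :=
      fun N M hN hNM => flow_uniq X hK (by exact_mod_cast hN) (by exact_mod_cast hNM)
        (hα N) (hα M) (by rw [hα0, hα0])
    refine ⟨fun t => α (‖t‖₊ + 1) t, by simp [hα0], fun t => ?_⟩
    have hev : (fun t => α (‖t‖₊ + 1) t) =ᶠ[nhds t] α (‖t‖₊ + 2) := by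
      have : ∀ᶠ s in nhds t, ‖s‖₊ < ‖t‖₊ + 1 :=
        (continuous_nnnorm.tendsto t).eventually_lt_const (by simp)
      filter_upwards [this] with s hs
      refine hcomp _ _ (by positivity) ?_ ?_
      · calc ‖s‖₊ + 1 ≤ (‖t‖₊ + 1) + 1 := by gcongr
          _ = ‖t‖₊ + 2 := by ring
      · have := abs_le.1 (le_refl |s|)
        constructor <;> simp <;> linarith [this.1, this.2]
    have ht : α (‖t‖₊ + 1) t = α (‖t‖₊ + 2) t := hev.eq_of_nhds
    show HasDerivAt _ (X (α (‖t‖₊ + 1) t)) t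
    rw [ht]
    refine HasDerivAt.congr_of_eventuallyEq ?_ hev
    have := abs_le.1 (le_refl |t|)
    refine (hα (‖t‖₊ + 2) t ⟨?_, ?_⟩).hasDerivAt (Icc_mem_nhds ?_ ?_) <;> simp <;>
      linarith [this.1, this.2]
  choose Φ h0 hd using key
  refine ⟨Φ, h0, hd, ?_, ?_, ?_⟩
  · intro t
    rw [continuous_iff_continuousAt]
    intro x
    obtain ⟨α, h, L', hL'⟩ := flow_exists_aux X hK hL x (‖t‖₊ + 1) 1
    have heq : ∀ y ∈ closedBall x (1:NNReal), α y t = Φ y t := by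
      intro y hy
      have := abs_le.1 (le_refl |t|)
      refine flow_uniq X hK (N := ((‖t‖₊ + 1 : NNReal) : ℝ)) (by positivity) le_rfl (h y hy).2
        (fun s _ => (hd y s).hasDerivWithinAt) (by rw [(h y hy).1, h0]) ⟨?_, ?_⟩ <;> simp <;>
      linarith [this.1, this.2]
    have hc : ContinuousAt (α · t) x := by
      have := abs_le.1 (le_refl |t|)
      refine (hL' t ⟨?_, ?_⟩).continuousOn.continuousAt (closedBall_mem_nhds _ (by simp)) <;>
        simp <;> linarith [this.1, this.2]
    refine hc.congr ?_
    filter_upwards [closedBall_mem_nhds x (show (0:ℝ) < (1:NNReal) by simp)] with y hy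
    exact heq y hy
  · intro x s t
    have := ODE_solution_unique_univ (v := fun _ => X) (s := fun _ => univ) (K := K) (t₀ := 0)
      (f := Φ (Φ x s)) (g := fun t => Φ x (s + t)) (fun _ => hK.lipschitzOnWith)
      (fun t => ⟨hd _ t, trivial⟩) (fun t => ⟨(hd x (s + t)).comp_const_add s t, trivial⟩)
      (by simp [h0])
    exact congrFun this t

  · intro x hx t
    have := ODE_solution_unique_univ (v := fun _ => X) (s := fun _ => univ) (K := K) (t₀ := 0)
      (f := Φ x) (g := fun t => x) (fun _ => hK.lipschitzOnWith)
      (fun t => ⟨hd _ t, trivial⟩) (fun t => ⟨by simpa [hx] using hasDerivAt_const t x, trivial⟩)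
      (by simp [h0])
    exact congrFun this t

/-- Regular points of `h`. -/
def RegPt (h : ℂ → ℝ) : Set ℂ := {l | ContDiffAt ℝ 6 h l ∧ fderiv ℝ h l ≠ 0}

theorem regPt_isOpen (h : ℂ → ℝ) : IsOpen (RegPt h) := by
  rw [isOpen_iff_mem_nhds]
  rintro l ⟨h1, h2⟩
  have e1 := h1.eventually (by simp)
  have e2 : ∀ᶠ x in nhds l, fderiv ℝ h x ≠ 0 :=
    (h1.continuousAt_fderiv (by simp)).eventually_ne h2
  filter_upwards [e1, e2] with x a b using ⟨a, b⟩

/-- The gradient of `h`, as a complex number. -/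
def cgrad (h : ℂ → ℝ) (l : ℂ) : ℂ := (fderiv ℝ h l 1 : ℝ) + (fderiv ℝ h l I : ℝ) * I

theorem fderiv_apply_c (L : ℂ →L[ℝ] ℝ) (x : ℂ) : L x = x.re * L 1 + x.im * L I := by
  have : x = x.re • (1:ℂ) + x.im • I := by
    apply Complex.ext <;> simp
  conv_lhs => rw [this]
  simp only [map_add, map_smul, smul_eq_mul]

theorem fderiv_cgrad (h : ℂ → ℝ) (l : ℂ) :
    fderiv ℝ h l (cgrad h l) = Complex.normSq (cgrad h l) := by
  rw [fderiv_apply_c, Complex.normSq_apply]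
  simp [cgrad]

theorem cgrad_ne {h : ℂ → ℝ} {l : ℂ} (hl : fderiv ℝ h l ≠ 0) : Complex.normSq (cgrad h l) ≠ 0 := by
  intro h0
  apply hl
  rw [Complex.normSq_eq_zero] at h0
  have h1 : fderiv ℝ h l 1 = 0 := by simpa [cgrad] using congrArg Complex.re h0
  have h2 : fderiv ℝ h l I = 0 := by simpa [cgrad] using congrArg Complex.im h0
  ext x
  rw [fderiv_apply_c, h1, h2]; simp

theorem gradflow (h : ℂ → ℝ) (C : Set ℂ) (hC : IsCompact C) (hCU : C ⊆ RegPt h) :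
    ∃ (χ : ℂ → ℝ) (Φ : ℂ → ℝ → ℂ), (∀ x, χ x ∈ Icc (0:ℝ) 1) ∧ (∀ x ∈ C, χ x = 1) ∧
      (∀ x, Φ x 0 = x) ∧ (∀ x, Continuous (Φ x)) ∧ (∀ t, Continuous (Φ · t)) ∧
      (∀ x s t, Φ (Φ x s) t = Φ x (s + t)) ∧
      ∀ x t, HasDerivAt (fun s => h (Φ x s)) (χ (Φ x t)) t := by
  obtain ⟨K', hK', hCK', hK'U⟩ := exists_compact_between hC (regPt_isOpen h) hCU
  obtain ⟨χ, hχ1, hχ0, hχ⟩ := exists_contMDiffMap_one_nhds_of_subset_interior (n := 6)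
    (modelWithCornersSelf ℝ ℂ) hC.isClosed hCK'
  have hχs : ContDiff ℝ 6 χ := χ.contMDiff.contDiff
  have hts : tsupport χ ⊆ K' := by
    refine closure_minimal (fun x hx => ?_) hK'.isClosed
    by_contra hx'
    exact hx (hχ0 x hx')
  set X : ℂ → ℂ := fun l => (χ l / Complex.normSq (cgrad h l) : ℝ) • cgrad h l with hX
  have hsupp : Function.support X ⊆ Function.support χ := by
    intro x hx hx'
    exact hx (by simp [hX, hx'])
  have htsX : tsupport X ⊆ K' := (closure_mono hsupp).trans hts
  have hcs : HasCompactSupport X := hK'.of_isClosed_subset (isClosed_tsupport _) htsX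
  have hXs : ContDiff ℝ 1 X := by
    refine contDiff_iff_contDiffAt.2 fun x => ?_
    by_cases hx : x ∈ tsupport X
    swap
    · exact (contDiffAt_const (c := (0:ℂ))).congr_of_eventuallyEq
        (notMem_tsupport_iff_eventuallyEq.1 hx)
    obtain ⟨h1, h2⟩ := hK'U (htsX hx)
    have hf : ContDiffAt ℝ 1 (fderiv ℝ h) x := h1.fderiv_right (m := 1) (by norm_num)
    have hg : ContDiffAt ℝ 1 (cgrad h) x := by
      unfold cgrad
      have a1 : ContDiffAt ℝ 1 (fun l => ((fderiv ℝ h l 1 : ℝ) : ℂ)) x :=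
        Complex.ofRealCLM.contDiff.contDiffAt.comp x (hf.clm_apply contDiffAt_const)
      have a2 : ContDiffAt ℝ 1 (fun l => ((fderiv ℝ h l I : ℝ) : ℂ)) x :=
        Complex.ofRealCLM.contDiff.contDiffAt.comp x (hf.clm_apply contDiffAt_const)
      exact a1.add (a2.mul contDiffAt_const)
    have hn : ContDiffAt ℝ 1 (fun l => Complex.normSq (cgrad h l)) x := by
      simp only [Complex.normSq_eq_norm_sq]
      exact hg.norm_sq ℝ
    exact ((hχs.contDiffAt.of_le (by norm_num)).div hn (cgrad_ne h2)).smul hg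
  obtain ⟨K, hK⟩ := hXs.lipschitzWith_of_hasCompactSupport hcs (by simp)
  obtain ⟨L, hL⟩ := hcs.exists_bound_of_continuous hXs.continuous
  have hL0 : 0 ≤ L := (norm_nonneg _).trans (hL 0)
  obtain ⟨Φ, h0, hd, hc, hgrp, hst⟩ := flow_exists X hK (L := ⟨L, hL0⟩) hL
  refine ⟨χ, Φ, hχ, fun x hx => hχ1.self_of_nhdsSet x hx, h0,
    fun x => continuous_iff_continuousAt.2 fun t => (hd x t).continuousAt, hc, hgrp, ?_⟩
  intro x t
  by_cases hp : Φ x t ∈ RegPt h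
  · have hd1 := (hp.1.differentiableAt (by simp)).hasFDerivAt.comp_hasDerivAt t (hd x t)
    have e : fderiv ℝ h (Φ x t) (X (Φ x t)) = χ (Φ x t) := by
      rw [hX]
      simp only [map_smul, fderiv_cgrad, smul_eq_mul]
      rw [div_mul_cancel₀ _ (cgrad_ne hp.2)]
    rw [e] at hd1
    exact hd1
  · have hχp : χ (Φ x t) = 0 := hχ0 _ fun hh => hp (hK'U hh)
    have hXp : X (Φ x t) = 0 := by simp [hX, hχp]
    have : (fun s => h (Φ x s)) = fun s => h (Φ x t) := by
      funext s
      have := hst _ hXp (s - t)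
      rw [hgrp] at this
      rw [← this]; congr 2; ring
    rw [this, hχp]
    exact hasDerivAt_const _ _

/-- Strict local minimum. -/
def SLMin (h : ℂ → ℝ) (l : ℂ) : Prop := ∀ᶠ x in nhds l, x ≠ l → h l < h x

theorem flow_mono {h : ℂ → ℝ} {χ : ℂ → ℝ} {Φ : ℂ → ℝ → ℂ} (hχ : ∀ x, χ x ∈ Icc (0:ℝ) 1)
    (hd : ∀ x t, HasDerivAt (fun s => h (Φ x s)) (χ (Φ x t)) t) (x : ℂ) :
    Monotone (fun s => h (Φ x s)) :=
  monotone_of_deriv_nonneg (fun t => (hd x t).differentiableAt)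
    (fun t => by rw [(hd x t).deriv]; exact (hχ _).1)

/-- Nested intersection of compact preconnected sets. -/
theorem nested_preconnected {K : ℕ → Set ℂ} (hanti : Antitone K) (hc : ∀ n, IsCompact (K n))
    (hp : ∀ n, IsPreconnected (K n)) : IsPreconnected (⋂ n, K n) := by
  rw [isPreconnected_closed_iff]
  intro u v hu hv huv hnu hnv
  by_contra hne
  have hcl : IsClosed (⋂ n, K n) := isClosed_iInter fun n => (hc n).isClosed
  have hcK : IsCompact (⋂ n, K n) := (hc 0).of_isClosed_subset hcl (iInter_subset _ 0)
  have hdis : Disjoint ((⋂ n, K n) ∩ u) ((⋂ n, K n) ∩ v) := by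
    rw [Set.disjoint_left]
    rintro x ⟨hx, hxu⟩ ⟨-, hxv⟩
    exact hne ⟨x, hx, hxu, hxv⟩
  obtain ⟨U, V, hU, hV, hsU, hsV, hUV⟩ :=
    SeparatedNhds.of_isCompact_isCompact (hcK.inter_right hu) (hcK.inter_right hv) hdis
  obtain ⟨n, hn⟩ : ∃ n, K n ⊆ U ∪ V := by
    refine exists_subset_nhds_of_isCompact' (directed_of_isDirected_le hanti) hc
      (fun n => (hc n).isClosed) fun x hx => (hU.union hV).mem_nhds ?_
    rcases huv hx with h | h
    · exact Or.inl (hsU ⟨hx, h⟩)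
    · exact Or.inr (hsV ⟨hx, h⟩)
  rcases IsPreconnected.subset_or_subset hU hV hUV hn (hp n) with h | h
  · obtain ⟨x, hx, hxv⟩ := hnv
    exact Set.disjoint_left.1 hUV (h (mem_iInter.1 hx n)) (hsV ⟨hx, hxv⟩)
  · obtain ⟨x, hx, hxu⟩ := hnu
    exact Set.disjoint_left.1 hUV (hsU ⟨hx, hxu⟩) (h (mem_iInter.1 hx n))

/-- Uniqueness of the strict local minimum (mountain pass argument). -/
theorem slmin_unique {h : ℂ → ℝ} (hcont : Continuous h) {R : ℝ} (hDc : IsCompact {l | h l ≤ R})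
    (hDp : IsPreconnected {l | h l ≤ R})
    (hcrit : ∀ l, h l ≤ R → SLMin h l ∨ l ∈ RegPt h) {e₁ e₂ : ℂ}
    (h₁ : SLMin h e₁) (h₂ : SLMin h e₂) (hle : h e₁ ≤ h e₂) (hR : h e₂ ≤ R) : e₁ = e₂ := by
  by_contra hne
  set T : Set ℝ := {τ | h e₂ ≤ τ ∧ ∃ K : Set ℂ, IsPreconnected K ∧ K ⊆ {l | h l ≤ τ} ∧ e₁ ∈ K ∧ e₂ ∈ K}
    with hT
  have hRT : R ∈ T := ⟨hR, _, hDp, subset_rfl, hle.trans hR, hR⟩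
  have hbdd : BddBelow T := ⟨h e₂, fun τ hτ => hτ.1⟩
  set t := sInf T with ht
  have htR : t ≤ R := csInf_le hbdd hRT
  have het : h e₂ ≤ t := le_csInf ⟨R, hRT⟩ fun τ hτ => hτ.1
  -- components
  have hclosed : ∀ τ, IsClosed {l | h l ≤ τ} := fun τ => isClosed_le hcont continuous_const
  have hup : ∀ τ, t < τ → e₂ ∈ connectedComponentIn {l | h l ≤ τ} e₁ := by
    intro τ hτ
    obtain ⟨τ', ⟨-, K, hK, hKs, h1, h2⟩, hlt⟩ := exists_lt_of_csInf_lt ⟨R, hRT⟩ hτ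
    exact hK.subset_connectedComponentIn h1
      (hKs.trans fun l (hl : h l ≤ τ') => hl.trans hlt.le) h2
  obtain ⟨K, hKc, hKp, hKs, hK1, hK2⟩ : ∃ K : Set ℂ, IsCompact K ∧ IsPreconnected K ∧
      K ⊆ {l | h l ≤ t} ∧ e₁ ∈ K ∧ e₂ ∈ K := by
    rcases htR.eq_or_lt with heq | hlt
    · exact ⟨_, heq ▸ hDc, heq ▸ hDp, subset_rfl, hle.trans het, het⟩
    obtain ⟨u, hu, hu1, hu2⟩ := exists_seq_strictAnti_tendsto' hlt
    set Kn : ℕ → Set ℂ := fun n => closure (connectedComponentIn {l | h l ≤ u n} e₁)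
    have hKn : ∀ n, Kn n ⊆ {l | h l ≤ u n} := fun n =>
      closure_minimal (connectedComponentIn_subset _ _) (hclosed _)
    have hcKn : ∀ n, IsCompact (Kn n) := fun n =>
      hDc.of_isClosed_subset isClosed_closure
        ((hKn n).trans fun l (hl : h l ≤ u n) => hl.trans (hu1 n).2.le)
    have hant : Antitone Kn := fun m n hmn => closure_mono
      (connectedComponentIn_mono _ fun l (hl : h l ≤ u n) => hl.trans (hu.antitone hmn))
    refine ⟨⋂ n, Kn n, ?_, nested_preconnected hant hcKn fun n =>
      isPreconnected_connectedComponentIn.closure, ?_, ?_, ?_⟩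
    · exact (hcKn 0).of_isClosed_subset (isClosed_iInter fun n => isClosed_closure)
        (iInter_subset _ 0)
    · intro l hl
      exact ge_of_tendsto' hu2 fun n => hKn n (mem_iInter.1 hl n)
    · exact mem_iInter.2 fun n => subset_closure
        (mem_connectedComponentIn (hle.trans (het.trans (hu1 n).1.le)))
    · exact mem_iInter.2 fun n => subset_closure (hup _ (hu1 n).1)
  -- no strict minima at level `t`
  have hnomin : ∀ p ∈ K, h p = t → ¬ SLMin h p := by
    intro p hp hpt hmin
    obtain ⟨O, hO, hOo, hpO⟩ := _root_.eventually_nhds_iff.1 hmin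
    have hsub : K ⊆ O ∪ {p}ᶜ := by
      intro x hx
      by_cases hxp : x = p
      · exact Or.inl (hxp ▸ hpO)
      · exact Or.inr hxp
    obtain ⟨q, hq, hqp⟩ : ∃ q ∈ K, q ≠ p := by
      by_cases h : e₁ = p
      · exact ⟨e₂, hK2, fun h' => hne (h.trans h'.symm)⟩
      · exact ⟨e₁, hK1, h⟩
    obtain ⟨x, hx, hxO, hxp⟩ := hKp O {p}ᶜ hOo isClosed_singleton.isOpen_compl hsub
      ⟨p, hp, hpO⟩ ⟨q, hq, hqp⟩
    have h1 := hO x hxO hxp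
    have h2 : h x ≤ t := hKs hx
    linarith
  have hlt : h e₂ < t := lt_of_le_of_ne het fun heq => hnomin e₂ hK2 heq h₂
  obtain ⟨χ, Φ, hχ, hχ1, h0, hcx, hct, hgrp, hd⟩ := gradflow h (K ∩ {l | h l = t})
    (hKc.inter_right (isClosed_eq hcont continuous_const)) (by
      rintro p ⟨hp, hpt⟩
      exact (hcrit p ((hKs hp).trans htR)).resolve_left (hnomin p hp hpt))
  have hm := flow_mono hχ hd
  have hle0 : ∀ x s, s ≤ 0 → h (Φ x s) ≤ h x := by
    intro x s hs
    have := hm x hs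
    simpa [h0] using this
  have hdec : ∀ p ∈ K, h (Φ p (-1)) < t := by
    intro p hp
    have hpt : h p ≤ t := hKs hp
    rcases hpt.lt_or_eq with hl | he
    · exact (hle0 p (-1) (by norm_num)).trans_lt hl
    · by_contra hcon
      push Not at hcon
      have hconst : ∀ s ∈ Icc (-1:ℝ) 0, h (Φ p s) = t := by
        intro s hs
        refine le_antisymm ((hle0 p s hs.2).trans hpt) (hcon.trans (hm p hs.1))
      have hder : HasDerivWithinAt (fun s => h (Φ p s)) 1 (Icc (-1:ℝ) 0) 0 := by
        have := (hd p 0).hasDerivWithinAt (s := Icc (-1:ℝ) 0)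
        rwa [h0, hχ1 p ⟨hp, he⟩] at this
      have hder' : HasDerivWithinAt (fun s => h (Φ p s)) 0 (Icc (-1:ℝ) 0) 0 :=
        (hasDerivWithinAt_const (0:ℝ) (Icc (-1:ℝ) 0) t).congr_of_mem hconst (by norm_num)
      have := (uniqueDiffOn_Icc (show (-1:ℝ) < 0 by norm_num) 0 (by norm_num)).eq_deriv _ hder hder'
      norm_num at this
  have hcI : IsCompact (Icc (-1:ℝ) 0) := isCompact_Icc
  have hpI : IsPreconnected (Icc (-1:ℝ) 0) := isPreconnected_Icc
  set K1 : Set ℂ := ((Φ · (-1)) '' K ∪ (Φ e₁) '' Icc (-1:ℝ) 0) ∪ (Φ e₂) '' Icc (-1:ℝ) 0 with hK1def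
  have hK1p : IsPreconnected K1 := by
    refine IsPreconnected.union (Φ e₂ (-1)) (Or.inl ⟨e₂, hK2, rfl⟩) ⟨-1, by norm_num, rfl⟩
      (IsPreconnected.union (Φ e₁ (-1)) ⟨e₁, hK1, rfl⟩ ⟨-1, by norm_num, rfl⟩ ?_ ?_) ?_
    · exact hKp.image _ (hct _).continuousOn
    · exact hpI.image _ (hcx _).continuousOn
    · exact hpI.image _ (hcx _).continuousOn
  have hK1c : IsCompact K1 :=
    ((hKc.image (hct _)).union (hcI.image (hcx _))).union (hcI.image (hcx _))
  have hK1lt : ∀ x ∈ K1, h x < t := by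
    rintro x ((⟨p, hp, rfl⟩ | ⟨s, hs, rfl⟩) | ⟨s, hs, rfl⟩)
    · exact hdec p hp
    · exact (hle0 _ _ hs.2).trans_lt (hle.trans_lt hlt)
    · exact (hle0 _ _ hs.2).trans_lt hlt
  have he1 : e₁ ∈ K1 := Or.inl (Or.inr ⟨0, by norm_num, h0 _⟩)
  have he2 : e₂ ∈ K1 := Or.inr ⟨0, by norm_num, h0 _⟩
  obtain ⟨m, hmK, hmax⟩ := hK1c.exists_isMaxOn ⟨e₁, he1⟩ hcont.continuousOn
  have : h m ∈ T := ⟨hmax he2, K1, hK1p, fun x hx => hmax hx, he1, he2⟩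
  have := csInf_le hbdd this
  linarith [hK1lt m hmK]

/-- Existence of the unique minimum. -/
theorem exists_min {h : ℂ → ℝ} (hcont : Continuous h) {R : ℝ} (hDc : IsCompact {l | h l ≤ R})
    (hDp : IsPreconnected {l | h l ≤ R})
    (hcrit : ∀ l, h l ≤ R → SLMin h l ∨ l ∈ RegPt h) (hne : {l | h l ≤ R}.Nonempty) :
    ∃ l₀, h l₀ ≤ R ∧ SLMin h l₀ ∧ (∀ l, l ≠ l₀ → h l₀ < h l) ∧ 
      (∀ l, h l ≤ R → l ≠ l₀ → l ∈ RegPt h) := by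
  have hmin : ∀ l, h l ≤ R → (∀ x, h l ≤ h x) → SLMin h l := by
    intro l hl hx
    refine (hcrit l hl).resolve_right fun hr => hr.2 ?_
    exact IsLocalMin.fderiv_eq_zero (Eventually.of_forall hx)
  obtain ⟨l₀, hl₀, hmin0⟩ := hDc.exists_isMinOn hne hcont.continuousOn
  have hglob : ∀ x, h l₀ ≤ h x := by
    intro x
    by_cases hx : h x ≤ R
    · exact hmin0 hx
    · exact le_trans hl₀ (not_le.1 hx).le
  have hs := hmin l₀ hl₀ hglob
  refine ⟨l₀, hl₀, hs, ?_, ?_⟩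
  · intro l hl
    refine lt_of_le_of_ne (hglob l) fun heq => hl ?_
    have hlR : h l ≤ R := heq ▸ hl₀
    exact (slmin_unique hcont hDc hDp hcrit hs (hmin l hlR (heq ▸ hglob)) heq.le hlR).symm
  · intro l hl hne'
    refine (hcrit l hl).resolve_left fun hm => hne' ?_
    exact (slmin_unique hcont hDc hDp hcrit hs hm (hglob l) hl).symm

/-- A sublevel set is homeomorphic to the whole disc. -/
theorem sublevel_homeo {h : ℂ → ℝ} (hcont : Continuous h) {R t : ℝ} (htR : t ≤ R)
    (hDc : IsCompact {l | h l ≤ R}) 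
    (hreg : ∀ l, t ≤ h l → h l ≤ R → l ∈ RegPt h) :
    Nonempty (↥{l | h l ≤ t} ≃ₜ ↥{l | h l ≤ R}) := by
  obtain ⟨χ, Φ, hχ, hχ1, h0, hcx, hct, hgrp, hd⟩ := gradflow h ({l | h l ≤ R} ∩ {l | t ≤ h l})
    (hDc.inter_right (isClosed_le continuous_const hcont)) (fun l hl => hreg l hl.2 hl.1)
  have hm := flow_mono hχ hd
  let e : ℂ ≃ₜ ℂ :=
    { toFun := fun x => Φ x (R - t)
      invFun := fun x => Φ x (-(R - t))
      left_inv := fun x => by simp [hgrp, h0]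
      right_inv := fun x => by simp [hgrp, h0]
      continuous_toFun := hct _
      continuous_invFun := hct _ }
  refine ⟨e.subtype fun x => ?_⟩
  show h x ≤ t ↔ h (Φ x (R - t)) ≤ R
  have hT : 0 ≤ R - t := by linarith
  constructor
  · intro hx
    have := Convex.image_sub_le_mul_sub_of_deriv_le (convex_Icc 0 (R - t)) (C := 1)
      (f := fun s => h (Φ x s))
      (fun s _ => (hd x s).continuousAt.continuousWithinAt)
      (fun s _ => (hd x s).differentiableAt.differentiableWithinAt)
      (fun s _ => by rw [(hd x s).deriv]; exact (hχ _).2) 0 ⟨le_rfl, hT⟩ (R - t) ⟨hT, le_rfl⟩ hT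
    simp only [h0] at this
    linarith
  · intro hx
    by_contra hcon
    push Not at hcon
    have hin : ∀ s ∈ Icc 0 (R - t), t ≤ h (Φ x s) ∧ h (Φ x s) ≤ R := by
      intro s hs
      refine ⟨?_, (hm x hs.2).trans hx⟩
      have := hm x hs.1
      simp only [h0] at this
      linarith
    have := Convex.mul_sub_le_image_sub_of_le_deriv (convex_Icc 0 (R - t)) (C := 1)
      (f := fun s => h (Φ x s))
      (fun s _ => (hd x s).continuousAt.continuousWithinAt)
      (fun s _ => (hd x s).differentiableAt.differentiableWithinAt)
      (fun s hs => by
        rw [(hd x s).deriv, hχ1 _ ⟨(hin s (interior_subset hs)).2, (hin s (interior_subset hs)).1⟩])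
      0 ⟨le_rfl, hT⟩ (R - t) ⟨hT, le_rfl⟩ hT
    simp only [h0] at this
    linarith

theorem ckBoundary_sublevel {h : ℂ → ℝ} (hcont : Continuous h) {t : ℝ}
    (hreg : ∀ l, h l = t → l ∈ RegPt h) : CkBoundary 6 {l | h l ≤ t} := by
  have hfr : frontier {l | h l ≤ t} = {l | h l = t} := by
    refine subset_antisymm (frontier_le_subset_eq hcont continuous_const) ?_
    intro l hl
    have hl' : h l = t := hl
    refine ⟨subset_closure hl'.le, fun hint => ?_⟩
    rw [mem_interior_iff_mem_nhds] at hint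
    refine (hreg l hl).2 (IsLocalMax.fderiv_eq_zero ?_)
    filter_upwards [hint] with x hx
    rw [hl']; exact hx
  intro p hp
  rw [hfr] at hp ⊢
  refine ⟨RegPt h, regPt_isOpen h, hreg p hp, fun x => h x - t, ?_, ?_, ?_⟩
  · intro x hx
    exact (hx.1.sub contDiffAt_const).contDiffWithinAt
  · intro x hx
    rw [fderiv_sub_const]
    exact hx.2
  · ext x
    simp [sub_eq_zero]

/-- The facts about a single fibre `g = ρ z` which are used. -/
structure Fibre {n : ℕ} (g : (Fin n → ℂ) → ℝ) (R : ℝ) (s : Fin n → ℂ) : Prop where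
  nonneg : ∀ w, 0 ≤ g w
  cont : Continuous g
  zero : ∀ w, g w = 0 ↔ w = s
  smooth : ∀ w, g w ≠ 0 → ContDiffAt ℝ 6 g w
  grad : ∀ w, 0 < g w → g w ≤ R → fderiv ℝ g w ≠ 0
  hypo : ∀ w, g w ≠ 0 → ∃ K0 > (0:ℝ), ∀ u : Fin n → ℂ, (∑ j, u j * wderiv g w j) = 0 →
      K0 * (euclNorm u)^2 ≤ iteratedFDeriv ℝ 2 g w ![u, u]
  ball : ∀ w, g w ≤ R ↔ euclNorm w ≤ R
  level : ∀ w, g w = R ↔ euclNorm w = R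

theorem euclNorm_eq {n : ℕ} (w : Fin n → ℂ) : euclNorm w = ‖WithLp.toLp 2 w‖ := by
  rw [EuclideanSpace.norm_eq, euclNorm]
  simp [Complex.normSq_eq_norm_sq]

theorem euclNorm_smul {n : ℕ} (x : ℂ) (w : Fin n → ℂ) : euclNorm (x • w) = ‖x‖ * euclNorm w := by
  rw [euclNorm_eq, euclNorm_eq, WithLp.toLp_smul, norm_smul]

theorem euclNorm_pos {n : ℕ} {w : Fin n → ℂ} (hw : w ≠ 0) : 0 < euclNorm w := by
  rw [euclNorm_eq, norm_pos_iff]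
  simpa using hw

theorem euclNorm_continuous {n : ℕ} : Continuous (euclNorm : (Fin n → ℂ) → ℝ) := by
  have : (euclNorm : (Fin n → ℂ) → ℝ) = fun w => ‖WithLp.toLp 2 w‖ := funext euclNorm_eq
  rw [this]
  exact (PiLp.continuous_toLp 2 _).norm

theorem norm_le_euclNorm {n : ℕ} (w : Fin n → ℂ) : ‖w‖ ≤ euclNorm w := by
  rw [euclNorm_eq, pi_norm_le_iff_of_nonneg (norm_nonneg _)]
  intro i
  exact PiLp.norm_apply_le (WithLp.toLp 2 w) i

theorem convex_euclBall {n : ℕ} (R : ℝ) : Convex ℝ {w : Fin n → ℂ | euclNorm w ≤ R} := by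
  have : {w : Fin n → ℂ | euclNorm w ≤ R} =
      (WithLp.linearEquiv 2 ℝ (Fin n → ℂ)).symm ⁻¹' (closedBall 0 R) := by
    ext w
    simp [euclNorm_eq]
  rw [this]
  exact (convex_closedBall _ _).linear_preimage _

theorem convex_euclBall_open {n : ℕ} (R : ℝ) : Convex ℝ {w : Fin n → ℂ | euclNorm w < R} := by
  have : {w : Fin n → ℂ | euclNorm w < R} =
      (WithLp.linearEquiv 2 ℝ (Fin n → ℂ)).symm ⁻¹' (ball 0 R) := by
    ext w
    simp [euclNorm_eq]
  rw [this]
  exact (convex_ball _ _).linear_preimage _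

theorem sum_wderiv {n : ℕ} (g : (Fin n → ℂ) → ℝ) (w u : Fin n → ℂ) :
    ∑ j, u j * wderiv g w j =
      ((fderiv ℝ g w u : ℝ) - Complex.I * (fderiv ℝ g w (Complex.I • u) : ℝ)) / 2 := by
  set F := fderiv ℝ g w with hF
  have hdec : ∀ u : Fin n → ℂ, F u = ∑ j, ((u j).re * F (Pi.single j 1) +
      (u j).im * F (Pi.single j Complex.I)) := by
    intro u
    have : u = ∑ j, ((u j).re • (Pi.single j 1 : Fin n → ℂ) + (u j).im • (Pi.single j Complex.I : Fin n → ℂ)) := by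
      ext i
      simp only [Finset.sum_apply, Pi.add_apply, Pi.smul_apply, Pi.single_apply]
      rw [Finset.sum_eq_single i]
      · apply Complex.ext <;> simp
      · intro b _ hb
        simp [Ne.symm hb]
      · simp
    conv_lhs => rw [this]
    simp only [map_sum, map_add, map_smul, smul_eq_mul]
  rw [hdec u, hdec (Complex.I • u)]
  push_cast
  rw [Finset.mul_sum, ← Finset.sum_sub_distrib, Finset.sum_div]
  refine Finset.sum_congr rfl fun j _ => ?_
  simp only [wderiv, ← hF, Pi.smul_apply, smul_eq_mul, Complex.mul_re, Complex.mul_im,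
    Complex.I_re, Complex.I_im]
  conv_lhs => rw [← Complex.re_add_im (u j)]
  push_cast
  ring_nf
  simp only [Complex.I_sq]
  ring

section
variable {n : ℕ} {g : (Fin n → ℂ) → ℝ} {R : ℝ} {s : Fin n → ℂ}

theorem Fibre.hasFDerivAt_line (G : Fibre g R s) (a v : Fin n → ℂ) (l : ℂ) (h0 : g (a + l • v) ≠ 0) :
    HasFDerivAt (fun l : ℂ => g (a + l • v))
      ((fderiv ℝ g (a + l • v)).comp ((ContinuousLinearMap.id ℝ ℂ).smulRight v)) l := by
  have h1 : HasFDerivAt (fun l : ℂ => a + l • v) ((ContinuousLinearMap.id ℝ ℂ).smulRight v) l := by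
    have := ((ContinuousLinearMap.id ℝ ℂ).smulRight v).hasFDerivAt (x := l)
    exact this.const_add a
  exact (((G.smooth _ h0).differentiableAt (by simp)).hasFDerivAt).comp l h1

theorem Fibre.crit (G : Fibre g R s) {a v : Fin n → ℂ} (hv : v ≠ 0) (l : ℂ) :
    SLMin (fun l : ℂ => g (a + l • v)) l ∨ l ∈ RegPt (fun l : ℂ => g (a + l • v)) := by
  by_cases h0 : g (a + l • v) = 0
  · left
    refine Eventually.of_forall fun x hx => ?_
    show g (a + l • v) < g (a + x • v)
    rw [h0]
    refine lt_of_le_of_ne (G.nonneg _) fun hh => hx ?_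
    have e1 := (G.zero _).1 h0
    have e2 := (G.zero _).1 hh.symm
    exact smul_left_injective ℂ hv (add_left_cancel (e2.trans e1.symm))
  have hline := G.hasFDerivAt_line a v l h0
  by_cases hd : fderiv ℝ (fun l : ℂ => g (a + l • v)) l = 0
  swap
  · right
    refine ⟨?_, hd⟩
    have h1 : ContDiff ℝ 6 (fun l : ℂ => a + l • v) := by fun_prop
    exact (G.smooth _ h0).comp l h1.contDiffAt
  left
  rw [hline.fderiv] at hd
  set p := a + l • v with hp
  have htan : ∀ x : ℂ, fderiv ℝ g p (x • v) = 0 := fun x => by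
    simpa using DFunLike.congr_fun hd x
  have htan' : ∀ x : ℂ, ∑ j, (x • v) j * wderiv g p j = 0 := fun x => by
    rw [sum_wderiv, htan, smul_smul, htan]; simp
  obtain ⟨K0, hK0, hK⟩ := G.hypo p h0
  have hHess : ∀ x : ℂ, K0 * (‖x‖ * euclNorm v)^2 ≤ fderiv ℝ (fderiv ℝ g) p (x • v) (x • v) := by
    intro x
    have := hK (x • v) (htan' x)
    rw [iteratedFDeriv_two_apply, euclNorm_smul] at this
    simpa using this
  have hsm := G.smooth p h0
  have hF : HasFDerivAt (fderiv ℝ g) (fderiv ℝ (fderiv ℝ g) p) p :=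
    ((hsm.fderiv_right (m := 1) (by norm_num)).differentiableAt (by simp)).hasFDerivAt
  set k := K0 * (euclNorm v)^2 with hk
  have hkpos : 0 < k := by have := euclNorm_pos hv; positivity
  have hvn : 0 < ‖v‖ := norm_pos_iff.2 hv
  have hc : 0 < k / (2 * ‖v‖^2) := by positivity
  have hlo := (hasFDerivAt_iff_isLittleO_nhds_zero.1 hF).def hc
  have hdf : ∀ᶠ y in nhds (0 : Fin n → ℂ), DifferentiableAt ℝ g (p + y) := by
    have h1 := hsm.eventually (by simp)
    have h2 : Tendsto (fun y : Fin n → ℂ => p + y) (nhds 0) (nhds p) := by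
      have : Continuous (fun y : Fin n → ℂ => p + y) := by fun_prop
      simpa using this.tendsto 0
    exact (h2.eventually h1).mono fun y hy => hy.differentiableAt (by simp)
  have htx : Tendsto (fun x : ℂ => x • v) (nhds 0) (nhds 0) := by
    have : Continuous (fun x : ℂ => x • v) := by fun_prop
    simpa using this.tendsto 0
  obtain ⟨ε, hε, hball⟩ := Metric.eventually_nhds_iff_ball.1 (htx.eventually (hlo.and hdf))
  have hpos : ∀ x ∈ Metric.ball (0:ℂ) ε, x ≠ 0 → 0 < fderiv ℝ g (p + x • v) (x • v) := by
    intro x hx hx0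
    have h1 := (hball x hx).1
    set y := x • v with hy
    have h2 := ContinuousLinearMap.le_opNorm (fderiv ℝ g (p + y) - fderiv ℝ g p -
      fderiv ℝ (fderiv ℝ g) p y) y
    have h3 : ‖y‖ = ‖x‖ * ‖v‖ := norm_smul _ _
    have h4 : ‖(fderiv ℝ g (p + y) - fderiv ℝ g p - fderiv ℝ (fderiv ℝ g) p y) y‖ ≤
        k / 2 * ‖x‖ ^ 2 := by
      calc _ ≤ _ := h2
        _ ≤ (k / (2 * ‖v‖^2) * ‖y‖) * ‖y‖ := by gcongr
        _ = k / 2 * ‖x‖ ^ 2 := by rw [h3]; field_simp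
    have h5 := (abs_le.1 h4).1
    simp only [sub_apply] at h5
    rw [htan x] at h5
    have h6 := hHess x
    have h7 : K0 * (‖x‖ * euclNorm v)^2 = k * ‖x‖^2 := by rw [hk]; ring
    have h8 : 0 < k * ‖x‖ ^ 2 := by have := norm_pos_iff.2 hx0; positivity
    linarith
  refine Metric.eventually_nhds_iff_ball.2 ⟨ε, hε, fun l' hl' hne => ?_⟩
  show g p < g (a + l' • v)
  set x := l' - l with hx
  have hx0 : x ≠ 0 := sub_ne_zero.2 hne
  have hxb : x ∈ Metric.ball (0:ℂ) ε := by
    rw [mem_ball, dist_eq] at hl'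
    rw [mem_ball_zero_iff]; exact hl'
  have hxt : ∀ τ ∈ Icc (0:ℝ) 1, (τ:ℂ) * x ∈ Metric.ball (0:ℂ) ε := by
    intro τ hτ
    rw [mem_ball_zero_iff] at hxb ⊢
    rw [norm_mul, Complex.norm_real, Real.norm_of_nonneg hτ.1]
    exact (mul_le_of_le_one_left (norm_nonneg _) hτ.2).trans_lt hxb
  have hder : ∀ τ ∈ Icc (0:ℝ) 1, HasDerivAt (fun τ : ℝ => g (p + ((τ:ℂ) * x) • v))
      (fderiv ℝ g (p + ((τ:ℂ) * x) • v) (x • v)) τ := by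
    intro τ hτ
    have h1 := ((hball _ (hxt τ hτ)).2).hasFDerivAt
    have h2 : HasDerivAt (fun τ : ℝ => p + ((τ:ℂ) * x) • v) (x • v) τ := by
      have h3 : HasDerivAt (fun τ : ℝ => (τ:ℂ)) 1 τ := Complex.ofRealCLM.hasDerivAt
      have := ((h3.mul_const x).smul_const v).const_add p
      simpa using this
    exact h1.comp_hasDerivAt τ h2
  have hmono : StrictMonoOn (fun τ : ℝ => g (p + ((τ:ℂ) * x) • v)) (Icc 0 1) := by
    refine strictMonoOn_of_deriv_pos (convex_Icc _ _)
      (fun τ hτ => (hder τ hτ).continuousAt.continuousWithinAt) fun τ hτ => ?_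
    rw [interior_Icc] at hτ
    have hτ' : τ ∈ Icc (0:ℝ) 1 := ⟨hτ.1.le, hτ.2.le⟩
    rw [(hder τ hτ').deriv]
    have h1 := hpos _ (hxt τ hτ') (mul_ne_zero (by exact_mod_cast hτ.1.ne') hx0)
    have h2 : ((τ:ℂ) * x) • v = τ • (x • v) := by
      rw [mul_smul]; rfl
    rw [h2, map_smul, smul_eq_mul] at h1
    rw [h2]
    exact (mul_pos_iff_of_pos_left hτ.1).1 h1
  have := hmono (left_mem_Icc.2 zero_le_one) (right_mem_Icc.2 zero_le_one) zero_lt_one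
  simp only [Complex.ofReal_zero, zero_mul, zero_smul, add_zero, Complex.ofReal_one, one_mul] at this
  have he : p + x • v = a + l' • v := by rw [hp, hx, sub_smul]; abel
  rwa [he] at this

theorem Fibre.line_cont (G : Fibre g R s) (a v : Fin n → ℂ) :
    Continuous (fun l : ℂ => g (a + l • v)) := G.cont.comp (by fun_prop)

theorem Fibre.sublevel_compact (G : Fibre g R s) {t : ℝ} (ht : t ≤ R) : IsCompact {w | g w ≤ t} := by
  refine Metric.isCompact_of_isClosed_isBounded (isClosed_le G.cont continuous_const) ?_
  refine (isBounded_closedBall (x := (0 : Fin n → ℂ)) (r := R)).subset fun w hw => ?_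
  rw [mem_closedBall_zero_iff]
  exact (norm_le_euclNorm w).trans ((G.ball w).1 (le_trans hw ht))

theorem Fibre.line_convex (G : Fibre g R s) (a v : Fin n → ℂ) :
    Convex ℝ {l : ℂ | g (a + l • v) ≤ R} := by
  have : {l : ℂ | g (a + l • v) ≤ R} =
      ((ContinuousLinearMap.id ℝ ℂ).smulRight v : ℂ →ₗ[ℝ] (Fin n → ℂ)) ⁻¹'
        ((fun w => a + w) ⁻¹' {w | euclNorm w ≤ R}) := by
    ext l
    simp [G.ball]
  rw [this]
  exact ((convex_euclBall R).translate_preimage_right a).linear_preimage _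

theorem Fibre.line_compact (G : Fibre g R s) (a : Fin n → ℂ) {v : Fin n → ℂ} (hv : v ≠ 0) :
    IsCompact {l : ℂ | g (a + l • v) ≤ R} := by
  refine Metric.isCompact_of_isClosed_isBounded
    (isClosed_le (G.line_cont a v) continuous_const) ?_
  refine (isBounded_closedBall (x := (0 : ℂ)) (r := (R + ‖a‖) / ‖v‖)).subset fun l hl => ?_
  rw [mem_closedBall_zero_iff, le_div_iff₀ (norm_pos_iff.2 hv), ← norm_smul]
  have h1 := (norm_le_euclNorm _).trans ((G.ball _).1 hl)
  have h2 := norm_sub_le (a + l • v) a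
  rw [add_sub_cancel_left] at h2
  linarith

theorem Fibre.line_min (G : Fibre g R s) (a : Fin n → ℂ) {v : Fin n → ℂ} (hv : v ≠ 0)
    (hne : {l : ℂ | g (a + l • v) ≤ R}.Nonempty) :
    ∃ l₀ : ℂ, g (a + l₀ • v) ≤ R ∧ SLMin (fun l : ℂ => g (a + l • v)) l₀ ∧
      (∀ l : ℂ, l ≠ l₀ → g (a + l₀ • v) < g (a + l • v)) ∧
      (∀ l : ℂ, g (a + l • v) ≤ R → l ≠ l₀ → l ∈ RegPt (fun l : ℂ => g (a + l • v))) :=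
  exists_min (G.line_cont a v) (G.line_compact a hv) (G.line_convex a v).isPreconnected
    (fun l _ => G.crit hv l) hne

/-- The tangent plane lies outside the sublevel set. -/
theorem Fibre.tangent (G : Fibre g R s) {p w : Fin n → ℂ} (hp0 : g p ≠ 0) (hpR : g p ≤ R)
    (hw : w ≠ p) (ht : ∑ j, (w j - p j) * wderiv g p j = 0) : g p < g w := by
  have hv : w - p ≠ 0 := sub_ne_zero.2 hw
  have hpe : p + (0:ℂ) • (w - p) = p := by simp
  obtain ⟨l₀, -, -, h2, h3⟩ := G.line_min p hv ⟨0, by simpa using hpR⟩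
  have h0 : (0:ℂ) = l₀ := by
    by_contra hne
    have hr := h3 0 (by rwa [hpe]) hne
    apply hr.2
    have := G.hasFDerivAt_line p (w - p) 0 (by rwa [hpe])
    rw [this.fderiv, hpe]
    have hs := sum_wderiv g p (w - p)
    have ht' : ∑ j, (w - p) j * wderiv g p j = 0 := ht
    rw [ht', eq_comm, div_eq_zero_iff] at hs
    have hs' := hs.resolve_right (by norm_num)
    have e1 : fderiv ℝ g p (w - p) = 0 := by simpa using congrArg Complex.re hs'
    have e2 : fderiv ℝ g p (Complex.I • (w - p)) = 0 := by simpa using congrArg Complex.im hs'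
    refine ContinuousLinearMap.ext fun x => ?_
    rw [fderiv_apply_c]
    simp [e1, e2]
  have := h2 1 (by rw [← h0]; exact one_ne_zero)
  rw [← h0, hpe] at this
  simpa using this

theorem Fibre.wderiv_ne (G : Fibre g R s) {p : Fin n → ℂ} (hp0 : g p ≠ 0) (hpR : g p ≤ R) :
    wderiv g p ≠ 0 := by
  intro h
  apply G.grad p (lt_of_le_of_ne (G.nonneg p) hp0.symm) hpR
  ext u
  have hs := sum_wderiv g p u
  rw [h, eq_comm] at hs
  simp only [Pi.zero_apply, mul_zero, Finset.sum_const_zero, div_eq_zero_iff] at hs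
  simpa using congrArg Complex.re (hs.resolve_right (by norm_num))

theorem Fibre.line_part (G : Fibre g R s) {t : ℝ} (htR : t < R) (a v : Fin n → ℂ) (hv : v ≠ 0)
    (hne : {l : ℂ | g (a + l • v) ≤ t}.Nonempty) :
    (∃ l₀ : ℂ, {l : ℂ | g (a + l • v) ≤ t} = {l₀}) ∨
      (Nonempty (↥{l : ℂ | g (a + l • v) ≤ t} ≃ₜ ↥(Metric.closedBall (0:ℂ) 1)) ∧
        CkBoundary 6 {l : ℂ | g (a + l • v) ≤ t}) := by
  obtain ⟨x, hx⟩ := hne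
  have hx' : g (a + x • v) ≤ t := hx
  obtain ⟨l₀, h1, -, h2, h3⟩ := G.line_min a hv ⟨x, hx'.trans htR.le⟩
  have hmin : ∀ l : ℂ, g (a + l₀ • v) ≤ g (a + l • v) := by
    intro l
    by_cases h : l = l₀
    · rw [h]
    · exact (h2 l h).le
  rcases ((hmin x).trans hx').eq_or_lt with heq | hlt
  · left
    refine ⟨l₀, ?_⟩
    ext l
    simp only [Set.mem_ofPred_eq, mem_singleton_iff]
    constructor
    · intro hl
      by_contra hh
      linarith [h2 l hh]
    · rintro rfl
      exact heq.le
  · right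
    have hreg : ∀ l : ℂ, t ≤ g (a + l • v) → g (a + l • v) ≤ R →
        l ∈ RegPt (fun l : ℂ => g (a + l • v)) := by
      intro l hl1 hl2
      refine h3 l hl2 ?_
      rintro rfl
      linarith
    refine ⟨?_, ckBoundary_sublevel (G.line_cont a v)
      fun l hl => hreg l (le_of_eq (Eq.symm hl)) ((le_of_eq hl).trans htR.le)⟩
    obtain ⟨e⟩ := sublevel_homeo (G.line_cont a v) htR.le (G.line_compact a hv) hreg
    have hint : (interior {l : ℂ | g (a + l • v) ≤ R}).Nonempty := by
      refine ⟨l₀, ?_⟩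
      rw [mem_interior]
      exact ⟨{l | g (a + l • v) < R}, fun l (hl : _ < R) => hl.le,
        isOpen_lt (G.line_cont a v) continuous_const, lt_trans hlt htR⟩
    obtain ⟨f, -, hf, -⟩ := exists_homeomorph_image_interior_closure_frontier_eq_unitBall
      (G.line_convex a v) hint (G.line_compact a hv).isBounded
    rw [(G.line_compact a hv).isClosed.closure_eq] at hf
    exact ⟨e.trans ((f.image _).trans (Homeomorph.setCongr hf))⟩

theorem Fibre.hypoconvex (G : Fibre g R s) {t : ℝ} (ht : 0 < t) (htR : t < R) :
    HypoconvexSet {w | g w ≤ t} := by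
  intro v hv
  have hv' : t < g v := not_le.1 hv
  by_cases hvR : g v ≤ R
  · have h0 : g v ≠ 0 := (ht.trans hv').ne'
    refine ⟨wderiv g v, ∑ j, wderiv g v j * v j, G.wderiv_ne h0 hvR, rfl, ?_⟩
    intro w hw heq
    have hw' : g w ≤ t := hw
    have hne : w ≠ v := by rintro rfl; linarith
    have := G.tangent h0 hvR hne (by
      simp only [sub_mul, Finset.sum_sub_distrib]
      rw [sub_eq_zero]
      simpa only [mul_comm] using heq)
    linarith
  · have hvn : R < euclNorm v := not_le.1 fun h => hvR ((G.ball v).2 h)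
    have hinner : ∀ w : Fin n → ℂ, ∑ j, (starRingEnd ℂ) (v j) * w j =
        inner ℂ (WithLp.toLp 2 v) (WithLp.toLp 2 w) := by
      intro w
      rw [PiLp.inner_apply]
      simp [mul_comm]
    have hR : 0 < R := ht.trans htR
    refine ⟨fun j => (starRingEnd ℂ) (v j), ∑ j, (starRingEnd ℂ) (v j) * v j, ?_, rfl, ?_⟩
    · intro h
      have : v = 0 := by
        ext j
        simpa using congrFun h j
      rw [this, euclNorm] at hvn
      simp at hvn
      linarith
    · intro w hw heq
      rw [hinner, hinner, inner_self_eq_norm_sq_to_K, ← euclNorm_eq] at heq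
      have h1 := norm_inner_le_norm (𝕜 := ℂ) (WithLp.toLp 2 v) (WithLp.toLp 2 w)
      rw [heq, ← euclNorm_eq, ← euclNorm_eq] at h1
      have h2 : euclNorm w ≤ R := (G.ball w).1 (le_trans hw htR.le)
      simp at h1
      nlinarith
end

theorem hull_unit {n : ℕ} {A : Set (Fin n → ℂ)} (hA : IsCompact A) (hne : A.Nonempty)
    (L : MvPolynomial (Fin n) ℂ) (hL : ∀ p ∈ polyHulln A, MvPolynomial.eval p L ≠ 0) :
    ∃ Q : MvPolynomial (Fin n) ℂ, ∀ x ∈ A,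
      ‖MvPolynomial.eval x Q * MvPolynomial.eval x L - 1‖ ≤ 1 / 2 := by
  have : CompactSpace A := isCompact_iff_compactSpace.1 hA
  have : Nonempty A := hne.to_subtype
  let c : Fin n → C(A, ℂ) := fun j => ⟨fun x => x.1 j, (continuous_apply j).comp continuous_subtype_val⟩
  let e : MvPolynomial (Fin n) ℂ →ₐ[ℂ] C(A, ℂ) := MvPolynomial.aeval c
  have he : ∀ P (x : A), e P x = MvPolynomial.eval x.1 P := by
    intro P x
    induction P using MvPolynomial.induction_on with
    | C a => simp [e]
    | add p q hp hq => simp [hp, hq]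
    | mul_X p i hp => simp [hp, e, c]
  let B : Subalgebra ℂ C(A, ℂ) := e.range.topologicalClosure
  have : CompleteSpace B :=
    (Subalgebra.isClosed_topologicalClosure e.range).completeSpace_coe
  let e' : MvPolynomial (Fin n) ℂ →ₐ[ℂ] B :=
    e.codRestrict B (fun P => Subalgebra.le_topologicalClosure _ ⟨P, rfl⟩)
  by_cases hu : IsUnit (e' L)
  · obtain ⟨u, hu⟩ := hu
    set b : B := (u⁻¹ : Bˣ).1 with hb
    have hbL : (b : C(A, ℂ)) * e L = 1 := by
      have : b * e' L = 1 := by rw [hb, ← hu, Units.inv_mul]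
      exact congrArg Subtype.val this
    have hbm : (b : C(A, ℂ)) ∈ closure (e.range : Set C(A, ℂ)) := b.2
    have hδ : 0 < 1 / (2 * (‖e L‖ + 1)) := by positivity
    obtain ⟨q, ⟨Q, rfl⟩, hq⟩ := Metric.mem_closure_iff.1 hbm _ hδ
    refine ⟨Q, fun x hx => ?_⟩
    have h1 : ‖e Q * e L - 1‖ ≤ 1 / 2 := by
      rw [← hbL, ← sub_mul]
      calc _ ≤ ‖e Q - b‖ * ‖e L‖ := norm_mul_le _ _
        _ ≤ (1 / (2 * (‖e L‖ + 1))) * (‖e L‖ + 1) := by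
          gcongr
          · rw [← dist_eq_norm, dist_comm]; exact hq.le
          · linarith
        _ = 1 / 2 := by field_simp
    have h2 := ((e Q * e L - 1).norm_coe_le_norm ⟨x, hx⟩).trans h1
    simpa [he] using h2
  · exfalso
    obtain ⟨φ, hφ⟩ := WeakDual.CharacterSpace.exists_apply_eq_zero hu
    let ψ : MvPolynomial (Fin n) ℂ →ₐ[ℂ] ℂ := (WeakDual.CharacterSpace.toAlgHom φ).comp e'
    let p : Fin n → ℂ := fun j => ψ (MvPolynomial.X j)
    have hψ : ∀ P, ψ P = MvPolynomial.eval p P := by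
      intro P
      have := MvPolynomial.aeval_unique ψ
      rw [this]
      rfl
    refine hL p ?_ ((hψ L).symm.trans hφ)
    intro P M hM
    rw [← hψ]
    have h1 : ψ P ∈ spectrum ℂ (e' P) :=
      AlgHom.apply_mem_spectrum (WeakDual.CharacterSpace.toAlgHom φ) (e' P)
    have h2 := spectrum.norm_le_norm_mul_of_mem h1
    have h3 : ‖(1 : B)‖ = 1 := by
      show ‖(1 : C(A, ℂ))‖ = 1
      exact norm_one
    rw [h3, mul_one] at h2
    refine h2.trans ?_
    show ‖e P‖ ≤ M
    rw [ContinuousMap.norm_le_of_nonempty]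
    intro x
    rw [he]
    exact hM _ x.2

theorem subset_hull {n : ℕ} (A : Set (Fin n → ℂ)) : A ⊆ polyHulln A :=
  fun w hw _ _ hM => hM w hw

theorem hull_mono {n : ℕ} {A B : Set (Fin n → ℂ)} (h : A ⊆ B) : polyHulln A ⊆ polyHulln B :=
  fun _ hw P M hM => hw P M fun v hv => hM v (h hv)

theorem hull_closed {n : ℕ} (A : Set (Fin n → ℂ)) : IsClosed (polyHulln A) := by
  have : polyHulln A = ⋂ (P : MvPolynomial (Fin n) ℂ) (M : ℝ)
      (_ : ∀ v ∈ A, ‖MvPolynomial.eval v P‖ ≤ M), {w | ‖MvPolynomial.eval w P‖ ≤ M} := by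
    ext w
    simp [polyHulln]
  rw [this]
  refine isClosed_iInter fun P => isClosed_iInter fun M => isClosed_iInter fun _ => ?_
  exact isClosed_le (MvPolynomial.continuous_eval P).norm continuous_const

theorem eval_differentiable {n : ℕ} (P : MvPolynomial (Fin n) ℂ) :
    Differentiable ℂ (fun w : Fin n → ℂ => MvPolynomial.eval w P) := by
  induction P using MvPolynomial.induction_on with
  | C a => simp
  | add p q hp hq => simp only [map_add]; exact hp.add hq
  | mul_X p i hp =>
    simp only [map_mul, MvPolynomial.eval_X]
    exact hp.mul (differentiable_apply i)

/-- The affine function with linear part `c` vanishing at `v`. -/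
def affPoly {n : ℕ} (c v : Fin n → ℂ) : MvPolynomial (Fin n) ℂ :=
  ∑ j, (MvPolynomial.X j - MvPolynomial.C (v j)) * MvPolynomial.C (c j)

theorem eval_affPoly {n : ℕ} (c v x : Fin n → ℂ) :
    MvPolynomial.eval x (affPoly c v) = ∑ j, (x j - v j) * c j := by
  simp [affPoly]

theorem hull_euclNorm {n : ℕ} {A : Set (Fin n → ℂ)} {r : ℝ}
    (hA : ∀ x ∈ A, euclNorm x ≤ r) {w : Fin n → ℂ} (hw : w ∈ polyHulln A) (hr : 0 ≤ r) :
    euclNorm w ≤ r := by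
  have hinner : ∀ x : Fin n → ℂ, MvPolynomial.eval x (affPoly (fun j => (starRingEnd ℂ) (w j)) 0) =
        inner ℂ (WithLp.toLp 2 w) (WithLp.toLp 2 x) := by
    intro x
    rw [PiLp.inner_apply, eval_affPoly]
    simp
  have h0 : 0 ≤ euclNorm w := Real.sqrt_nonneg _
  have h1 := hw (affPoly (fun j => (starRingEnd ℂ) (w j)) 0) (euclNorm w * r) (by
    intro x hx
    rw [hinner]
    refine (norm_inner_le_norm _ _).trans ?_
    rw [← euclNorm_eq, ← euclNorm_eq]
    exact mul_le_mul_of_nonneg_left (hA x hx) h0)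
  rw [hinner, inner_self_eq_norm_sq_to_K, ← euclNorm_eq] at h1
  simp at h1
  rcases h0.eq_or_lt with h | h
  · rw [← h]; exact hr
  · nlinarith

section
variable {n : ℕ} {g : (Fin n → ℂ) → ℝ} {R : ℝ} {s : Fin n → ℂ}

theorem Fibre.hull_level [NeZero n] (G : Fibre g R s) {t : ℝ} (htR : t ≤ R) :
    {w | g w ≤ t} ⊆ polyHulln {w | g w = t} := by
  intro w hw P M hM
  have hw' : g w ≤ t := hw
  rcases hw'.eq_or_lt with h | h
  · exact hM w h
  have : Nonempty (Fin n) := ⟨0⟩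
  refine Complex.norm_le_of_forall_mem_frontier_norm_le (U := {w | g w < t})
    ((G.sublevel_compact htR).isBounded.subset fun x (hx : g x < t) => hx.le)
    (eval_differentiable P).diffContOnCl (fun x hx => hM x ?_) (subset_closure h)
  exact frontier_lt_subset_eq G.cont continuous_const hx

theorem Fibre.wderiv_cont (G : Fibre g R s) {p : Fin n → ℂ} (hp : g p ≠ 0) :
    ContinuousAt (fun w => wderiv g w) p := by
  have h1 : ContinuousAt (fderiv ℝ g) p :=
    ((G.smooth p hp).fderiv_right (m := 1) (by norm_num)).continuousAt
  refine continuousAt_pi.2 fun j => ?_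
  unfold wderiv
  have h2 : ∀ u : Fin n → ℂ, ContinuousAt (fun w => ((fderiv ℝ g w u : ℝ) : ℂ)) p := fun u =>
    Complex.continuous_ofReal.continuousAt.comp (h1.clm_apply continuousAt_const)
  exact ((h2 _).sub (continuousAt_const.mul (h2 _))).div_const 2

theorem Fibre.polyConvex (G : Fibre g R s) {t : ℝ} (ht : 0 < t) (htR : t < R) :
    polyHulln {w | g w ≤ t} = {w | g w ≤ t} := by
  set A := {w | g w ≤ t} with hA
  have hAc : IsCompact A := G.sublevel_compact htR.le
  have hsA : s ∈ A := by
    show g s ≤ t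
    rw [(G.zero s).2 rfl]; exact ht.le
  refine Subset.antisymm ?_ (subset_hull A)
  intro v hv
  by_contra hvA
  have hvt : t < g v := not_le.1 hvA
  have hR0 : 0 < R := ht.trans htR
  have hhR : ∀ x ∈ polyHulln A, g x ≤ R := fun x hx =>
    (G.ball x).2 (hull_euclNorm (fun y hy => (G.ball y).1 (le_trans hy htR.le)) hx hR0.le)
  have hHc : IsCompact (polyHulln A) :=
    (G.sublevel_compact le_rfl).of_isClosed_subset (hull_closed A) hhR
  obtain ⟨p, hpH, hpmax⟩ := hHc.exists_isMaxOn ⟨v, hv⟩ G.cont.continuousOn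
  have hmax : ∀ x ∈ polyHulln A, g x ≤ g p := fun x hx => hpmax hx
  have htp : t < g p := hvt.trans_le (hmax v hv)
  have hp0 : g p ≠ 0 := (ht.trans htp).ne'
  -- the maximum is below `R`
  have hpR : g p < R := by
    obtain ⟨q, hqA, hq⟩ := hAc.exists_isMaxOn ⟨s, hsA⟩ euclNorm_continuous.continuousOn
    have hqt : g q ≤ t := hqA
    have hqR : euclNorm q ≤ R := (G.ball q).1 (hqt.trans htR.le)
    have hpq : euclNorm p ≤ euclNorm q := hull_euclNorm (fun y hy => hq hy) hpH (Real.sqrt_nonneg _)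
    refine lt_of_le_of_ne (hhR p hpH) fun hpe => ?_
    have e1 := (G.level p).1 hpe
    have e2 := (G.level q).2 (le_antisymm hqR (e1 ▸ hpq))
    linarith
  -- lower bound for the affine functions near `p`
  have hLp : ∀ x ∈ A, ∑ j, (x j - p j) * wderiv g p j ≠ 0 := by
    intro x hx h
    have hx' : g x ≤ t := hx
    have := G.tangent hp0 hpR.le (by rintro rfl; linarith) h
    linarith
  have hF : ContinuousAt (fun q : (Fin n → ℂ) => (q, wderiv g q)) p :=
    continuousAt_id.prodMk (G.wderiv_cont hp0)
  let Φ : ((Fin n → ℂ) × (Fin n → ℂ)) × (Fin n → ℂ) → ℂ := fun y => ∑ j, (y.2 j - y.1.1 j) * y.1.2 j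
  have hΦ : Continuous Φ := by fun_prop
  obtain ⟨m, hmA, hm⟩ := hAc.exists_isMinOn ⟨s, hsA⟩
    (f := fun x => ‖Φ ((p, wderiv g p), x)‖) (by fun_prop)
  set δ := ‖Φ ((p, wderiv g p), m)‖ with hδ
  have hδ0 : 0 < δ := norm_pos_iff.2 (hLp m hmA)
  have hev : ∀ᶠ y in nhds (p, wderiv g p), ∀ x ∈ A, δ / 2 < ‖Φ (y, x)‖ := by
    refine hAc.eventually_forall_of_forall_eventually fun x hx => ?_
    have h1 : δ / 2 < ‖Φ ((p, wderiv g p), x)‖ := by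
      have : δ ≤ ‖Φ ((p, wderiv g p), x)‖ := hm hx
      linarith
    exact hΦ.norm.continuousAt.eventually (lt_mem_nhds h1)
  have hsmall : ∀ᶠ y in nhds (p, wderiv g p), ‖Φ (y, p)‖ < δ / 8 := by
    have h1 : ContinuousAt (fun y => ‖Φ (y, p)‖) (p, wderiv g p) := by fun_prop
    refine h1.eventually (gt_mem_nhds ?_)
    have : Φ ((p, wderiv g p), p) = 0 := by simp [Φ]
    show ‖Φ ((p, wderiv g p), p)‖ < δ / 8
    rw [this, norm_zero]
    positivity
  have hRev : ∀ᶠ q in nhds p, g q < R := G.cont.continuousAt.eventually (gt_mem_nhds hpR)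
  have hnotmax : ∃ᶠ q in nhds p, g p < g q := by
    intro hcon
    refine G.grad p (lt_of_le_of_ne (G.nonneg p) hp0.symm) hpR.le ?_
    have : IsLocalMax g p := hcon.mono fun q hq => not_lt.1 hq
    exact this.fderiv_eq_zero
  obtain ⟨q, hq1, hq2, hq3, hq4⟩ :=
    (hnotmax.and_eventually (hRev.and ((hF.eventually hev).and (hF.eventually hsmall)))).exists
  have hq0 : g q ≠ 0 := ((ht.trans htp).trans hq1).ne'
  set L := affPoly (wderiv g q) q with hL
  have hLe : ∀ x, MvPolynomial.eval x L = Φ ((q, wderiv g q), x) := fun x => eval_affPoly _ _ x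
  obtain ⟨Q, hQ⟩ := hull_unit hAc ⟨s, hsA⟩ L (by
    intro x hx h
    rw [hL, eval_affPoly] at h
    have h1 := hmax x hx
    have := G.tangent hq0 hq2.le (by rintro rfl; linarith) h
    linarith)
  have h1 := hpH (Q * L - 1) (1 / 2) (by
    intro x hx
    simpa using hQ x hx)
  have h2 := hpH Q (3 / δ) (by
    intro x hx
    have e1 := hQ x hx
    have e2 := hq3 x hx
    rw [← hLe] at e2
    have e3 : ‖MvPolynomial.eval x Q * MvPolynomial.eval x L‖ ≤ 3 / 2 := by
      have := norm_le_norm_add_norm_sub' (MvPolynomial.eval x Q * MvPolynomial.eval x L) 1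
      rw [norm_one] at this
      linarith
    rw [norm_mul] at e3
    rw [le_div_iff₀ hδ0]
    nlinarith [norm_nonneg (MvPolynomial.eval x Q)])
  simp only [map_sub, map_mul, map_one] at h1
  rw [← hLe] at hq4
  have h3 : ‖MvPolynomial.eval p Q * MvPolynomial.eval p L‖ ≤ 3 / 8 := by
    rw [norm_mul]
    calc _ ≤ (3 / δ) * (δ / 8) := by gcongr
      _ = 3 / 8 := by field_simp
  have h4 := norm_le_norm_add_norm_sub' (1 : ℂ) (MvPolynomial.eval p Q * MvPolynomial.eval p L)
  rw [norm_one, norm_sub_rev] at h4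
  linarith
end

theorem Cond3.fibre {n : ℕ} {ρ : ℂ → (Fin n → ℂ) → ℝ} {R : ℝ} {S : ℂ → Fin n → ℂ}
    (hρ : Cond3 n ρ R S) {z : ℂ} (hz : z ∈ Circ) : Fibre (ρ z) R (S z) := by
  have hmk : Continuous (fun w : Fin n → ℂ => (z, w)) := by fun_prop
  have hcont : Continuous (ρ z) := by
    rw [← continuousOn_univ]
    exact hρ.cont.comp hmk.continuousOn (fun w _ => hz)
  refine ⟨hρ.nonneg z hz, hcont, hρ.Szero z hz, ?_, hρ.grad_ne z hz, ?_, ?_, hρ.levelR z hz⟩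
  · intro w hw
    have hd : ContDiff ℝ 6 (fun w : Fin n → ℂ => (z, w)) := by fun_prop
    have h1 : ContDiffOn ℝ 6 (ρ z) {w | ρ z w ≠ 0} :=
      hρ.smooth.comp hd.contDiffOn (fun w hw => ⟨hz, hw⟩)
    exact h1.contDiffAt ((isOpen_ne_fun hcont continuous_const).mem_nhds hw)
  · intro w hw
    obtain ⟨K0, hK0, h⟩ := hρ.hypo {(z, w)} (by
      rintro _ rfl
      exact ⟨hz, hw⟩) isCompact_singleton
    exact ⟨K0, hK0, h (z, w) rfl⟩
  · intro w
    constructor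
    · intro h
      by_contra hh
      linarith [hρ.aboveR z hz w (not_le.1 hh)]
    · intro h
      rcases h.eq_or_lt with h | h
      · exact ((hρ.levelR z hz w).2 h).le
      · by_contra hh
        have h0 : ρ z (S z) = 0 := (hρ.Szero z hz _).2 rfl
        have hR := hρ.hR
        obtain ⟨x, hx, hxR⟩ := (convex_euclBall_open (n := n) R).isPreconnected.intermediate_value
          (hρ.Ssmall z hz) h hcont.continuousOn (show R ∈ Icc (ρ z (S z)) (ρ z w) from
            ⟨by rw [h0]; linarith, (not_le.1 hh).le⟩)
        have := (hρ.levelR z hz x).1 hxR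
        have hx' : euclNorm x < R := hx
        linarith

/-- properties of the closed fiber domains `D^t_z`. -/
theorem statement15 {n : ℕ} (ρ : ℂ → (Fin n → ℂ) → ℝ) (R : ℝ) (S : ℂ → Fin n → ℂ)
    (hρ : Cond3 n ρ R S)
    (t : ℝ) (ht : 0 < t) (htR : t < R) (z : ℂ) (hz : z ∈ Circ) :
    polyHulln {w : Fin n → ℂ | ρ z w ≤ t} = {w : Fin n → ℂ | ρ z w ≤ t} ∧
    polyHulln {w : Fin n → ℂ | ρ z w = t} = {w : Fin n → ℂ | ρ z w ≤ t} ∧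
    HypoconvexSet {w : Fin n → ℂ | ρ z w ≤ t} ∧
    (∀ w : Fin n → ℂ, ρ z w = t → ∀ u : Fin n → ℂ, u ≠ 0 →
      (∑ j, u j * wderiv (ρ z) w j) = 0 → 0 < iteratedFDeriv ℝ 2 (ρ z) w ![u, u]) ∧
    (∀ a v : Fin n → ℂ, v ≠ 0 →
      ∀ Λ : Set ℂ, Λ = {l : ℂ | ρ z (fun j => a j + l * v j) ≤ t} → Λ.Nonempty →
        ((∃ l₀ : ℂ, Λ = {l₀}) ∨
          (Nonempty (↥Λ ≃ₜ ↥(Metric.closedBall (0:ℂ) 1)) ∧ CkBoundary 6 Λ))) := by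
  have G := hρ.fibre hz
  have : NeZero n := ⟨by have := hρ.hn; omega⟩
  refine ⟨G.polyConvex ht htR, ?_, G.hypoconvex ht htR, ?_, ?_⟩
  · refine Subset.antisymm ?_ (G.hull_level htR.le)
    refine (hull_mono (B := {w : Fin n → ℂ | ρ z w ≤ t}) fun w hw => le_of_eq hw).trans ?_
    rw [G.polyConvex ht htR]
  · intro w hw u hu hut
    obtain ⟨K0, hK0, h⟩ := G.hypo w (by rw [hw]; exact ht.ne')
    have := euclNorm_pos hu
    exact lt_of_lt_of_le (by positivity) (h u hut)
  · rintro a v hv Λ rfl hne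
    exact G.line_part htR a v hv hne
end
end
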